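/- Let f ∈ C⁰(ℝ) ∩ C²((0,∞)) be nondecreasing on ℝ, odd, with restriction to (0,∞) convex and positive; assume q₀ = lim_{u→0⁺} q(u) exists with conjugate p₀, and set q̄_∞ = limsup_{u→+∞} q(u) with conjugate exponent p̲_∞ (1/p̲_∞ + 1/q̄_∞ = 1). Let u ∈ C²(ℝ^N) be any stable solution of −Δu = f(u) in ℝ^N (not assumed bounded or of a definite sign). Then u ≡ 0 if either (1) 1 ≤ N ≤ 9, 1 < p₀ and 1 < p̲_∞, or (2) N = 10, 1 < p₀ < +∞ and 1 < p̲_∞ < +∞, or (3) N ≥ 11, 1 < p₀ < p_c(N) and 1 < p̲_∞ < p_c(N). -/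

import Mathlib

open MeasureTheory Filter Topology
open scoped ENNReal

/-- The Laplacian of `u : ℝ^N → ℝ`. -/
noncomputable def lap {N : ℕ} (u : EuclideanSpace ℝ (Fin N) → ℝ)
    (x : EuclideanSpace ℝ (Fin N)) : ℝ :=
  ∑ i : Fin N, iteratedFDeriv ℝ 2 u x ![EuclideanSpace.single i 1, EuclideanSpace.single i 1]

/-- `u` is a stable solution w.r.t. the linearized weight `g = f'`:
`∫ f'(u) φ² ≤ ∫ |∇φ|²` for all `φ ∈ C¹_c(ℝ^N)`. -/
def Stable {N : ℕ} (g : ℝ → ℝ) (u : EuclideanSpace ℝ (Fin N) → ℝ) : Prop :=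
  ∀ φ : EuclideanSpace ℝ (Fin N) → ℝ, ContDiff ℝ 1 φ → HasCompactSupport φ →
    ∫ x, g (u x) * (φ x) ^ 2 ≤ ∫ x, ‖gradient φ x‖ ^ 2

/-- `u` is stable outside the set `K` : the stability inequality holds for all
`φ ∈ C¹_c(ℝ^N \ K)`. -/
def StableOutside {N : ℕ} (g : ℝ → ℝ) (u : EuclideanSpace ℝ (Fin N) → ℝ)
    (K : Set (EuclideanSpace ℝ (Fin N))) : Prop :=
  ∀ φ : EuclideanSpace ℝ (Fin N) → ℝ, ContDiff ℝ 1 φ → HasCompactSupport φ →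
    tsupport φ ⊆ Kᶜ →
    ∫ x, g (u x) * (φ x) ^ 2 ≤ ∫ x, ‖gradient φ x‖ ^ 2

/-- The quantity `q(u) = f'(u)²/(f(u) f''(u)) ∈ [0,∞]`, with the convention
`q(u) = +∞` when `f(u) f''(u) = 0`. -/
noncomputable def qfun (f : ℝ → ℝ) (t : ℝ) : ℝ≥0∞ :=
  if f t * deriv (deriv f) t = 0 then ⊤
  else ENNReal.ofReal ((deriv f t) ^ 2 / (f t * deriv (deriv f) t))

/-- The Joseph–Lundgren exponent `p_c(N)` (for `N ≥ 11`). -/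
noncomputable def pc (N : ℕ) : ℝ :=
  (((N : ℝ) - 2) ^ 2 - 4 * N + 8 * Real.sqrt ((N : ℝ) - 1)) / (((N : ℝ) - 2) * ((N : ℝ) - 10))

/-- `f` is an odd nonlinearity of class `C¹(ℝ)`, positive and convex on `(0,∞)`, with first
derivative `f₁` on `ℝ` and second derivative `f₂` on `(0,∞)`. -/
structure OddConvex (f f₁ f₂ : ℝ → ℝ) : Prop where
  hasDerivAt : ∀ t, HasDerivAt f (f₁ t) t
  continuous_deriv : Continuous f₁
  hasDerivAt_deriv : ∀ t, 0 < t → HasDerivAt f₁ (f₂ t) t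
  odd : ∀ t, f (-t) = -f t
  deriv_even : ∀ t, f₁ (-t) = f₁ t
  pos : ∀ t, 0 < t → 0 < f t
  deriv_pos : ∀ t, 0 < t → 0 < f₁ t
  deriv2_nonneg : ∀ t, 0 < t → 0 ≤ f₂ t

theorem oddConvex_of_convexOn {f : ℝ → ℝ} (hcont : Continuous f)
    (hC2 : ContDiffOn ℝ 2 f (Set.Ioi 0)) (hmono : Monotone f) (hodd : ∀ t : ℝ, f (-t) = -f t)
    (hconv : ConvexOn ℝ (Set.Ioi 0) f) (hpos : ∀ t : ℝ, 0 < t → 0 < f t) :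
    OddConvex f (deriv f) (deriv (deriv f)) := by
  have h0 : f 0 = 0 := by have := hodd 0; simp at this; linarith
  have hC1 : ContDiffOn ℝ 1 (deriv f) (Set.Ioi 0) :=
    ((contDiffOn_succ_iff_deriv_of_isOpen (n := 1) isOpen_Ioi).1
      (by simpa [one_add_one_eq_two] using hC2)).2.2
  have hd : ∀ t, 0 < t → DifferentiableAt ℝ f t := fun t ht =>
    (hC2.differentiableOn (by norm_num)).differentiableAt (Ioi_mem_nhds ht)
  have hd2 : ∀ t, 0 < t → DifferentiableAt ℝ (deriv f) t := fun t ht =>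
    (hC1.differentiableOn (by norm_num)).differentiableAt (Ioi_mem_nhds ht)
  have heven : ∀ t, deriv f (-t) = deriv f t := by
    intro t
    have h1 : (fun x => f (-x)) = fun x => -f x := funext hodd
    have h2 := deriv_comp_neg f t
    rw [h1, deriv.fun_neg] at h2
    linarith
  have hnn : ∀ t, 0 ≤ deriv f t := fun t => hmono.deriv_nonneg
  have hm1 : MonotoneOn (deriv f) (Set.Ioi 0) := hconv.monotoneOn_deriv fun x hx => hd x hx
  have hdneg : ∀ t, t < 0 → DifferentiableAt ℝ f t := by
    intro t ht
    have h1 : f = fun x => -f (-x) := by funext x; rw [hodd]; ring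
    rw [h1]
    have : DifferentiableAt ℝ (fun x => f (-x)) t :=
      (hd (-t) (by linarith)).comp t differentiable_neg.differentiableAt
    exact this.neg
  obtain ⟨L, hL⟩ : ∃ L, Tendsto (deriv f) (𝓝[>] 0) (𝓝 L) :=
    ⟨_, hm1.tendsto_nhdsGT ⟨0, by rintro _ ⟨t, -, rfl⟩; exact hnn t⟩⟩
  have hL' : Tendsto (deriv f) (𝓝[<] 0) (𝓝 L) := by
    have h1 : Tendsto (fun t : ℝ => -t) (𝓝[<] 0) (𝓝[>] 0) := by
      simpa using tendsto_neg_nhdsLT (a := (0:ℝ))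
    exact (hL.comp h1).congr fun t => by simp [heven]
  have hD0 : HasDerivAt f L 0 := by
    have h1 := hasDerivWithinAt_Ici_of_tendsto_deriv (s := Set.Ioi 0)
      (fun x hx => (hd x hx).differentiableWithinAt) hcont.continuousWithinAt
      self_mem_nhdsWithin hL
    have h2 := hasDerivWithinAt_Iic_of_tendsto_deriv (s := Set.Iio 0)
      (fun x hx => (hdneg x hx).differentiableWithinAt) hcont.continuousWithinAt
      self_mem_nhdsWithin hL'
    have h3 := h2.union h1
    rwa [Set.Iic_union_Ici, hasDerivWithinAt_univ] at h3
  have hdiff : ∀ t, DifferentiableAt ℝ f t := by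
    intro t
    rcases lt_trichotomy t 0 with h | rfl | h
    · exact hdneg t h
    · exact hD0.differentiableAt
    · exact hd t h
  have hcd : Continuous (deriv f) := by
    rw [continuous_iff_continuousAt]
    intro t
    rcases lt_trichotomy t 0 with h | rfl | h
    · have h1 : deriv f = fun x => deriv f (-x) := by funext x; rw [heven]
      rw [h1]
      exact ContinuousAt.comp (f := fun x : ℝ => -x) (hd2 (-t) (by linarith)).continuousAt
        continuous_neg.continuousAt
    · rw [continuousAt_iff_punctured_nhds, ← nhdsLT_sup_nhdsGT, hD0.deriv]
      exact hL'.sup hL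
    · exact (hd2 t h).continuousAt
  refine ⟨fun t => (hdiff t).hasDerivAt, hcd, fun t ht => (hd2 t ht).hasDerivAt, hodd, heven,
    hpos, ?_, ?_⟩
  · intro t ht
    obtain ⟨c, hc, hc'⟩ := exists_deriv_eq_slope f ht hcont.continuousOn
      fun x _ => (hdiff x).differentiableWithinAt
    have h1 : 0 < deriv f c := by
      rw [hc', h0]
      have := hpos t ht
      simp only [sub_zero]; positivity
    exact h1.trans_le (hm1 hc.1 (Set.mem_Ioi.2 ht) hc.2.le)
  · intro t ht
    have h1 := hm1.derivWithin_nonneg (x := t)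
    rwa [derivWithin_of_isOpen isOpen_Ioi ht] at h1

/-- The truncated distance of `|s|` to the level `s₀`. -/
noncomputable def gapBelow (s₀ s : ℝ) : ℝ := max (s₀ - |s|) 0

/-- An even amplification factor behaving like `|s| ^ ρ` near `0` and constant for `|s| ≥ s₀`. -/
noncomputable def ampl (ρ s₀ s : ℝ) : ℝ := (s₀ ^ 2 - gapBelow s₀ s ^ 2) ^ ρ

/-- The logarithmic derivative `s G'(s) / G(s)` of `G = ampl ρ s₀`. -/
noncomputable def amplLog (ρ s₀ s : ℝ) : ℝ := ρ * (2 * gapBelow s₀ s / (s₀ + gapBelow s₀ s))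

theorem hasDerivAt_max_zero_pow (n : ℕ) (x : ℝ) :
    HasDerivAt (fun y : ℝ => max y 0 ^ (n + 2)) ((n + 2) * max x 0 ^ (n + 1)) x := by
  have key : ∀ y : ℝ, y ≠ 0 →
      HasDerivAt (fun y : ℝ => max y 0 ^ (n + 2)) ((n + 2) * max y 0 ^ (n + 1)) y := by
    intro y hy
    rcases lt_or_gt_of_ne hy with h | h
    · have h1 : (fun y : ℝ => max y 0 ^ (n + 2)) =ᶠ[𝓝 y] fun _ => 0 := by
        filter_upwards [Iio_mem_nhds h] with z hz
        simp [max_eq_right (Set.mem_Iio.1 hz).le]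
      rw [max_eq_right h.le]
      simpa using (hasDerivAt_const y (0 : ℝ)).congr_of_eventuallyEq h1
    · have h1 : (fun y : ℝ => max y 0 ^ (n + 2)) =ᶠ[𝓝 y] fun y => y ^ (n + 2) := by
        filter_upwards [Ioi_mem_nhds h] with z hz
        simp [max_eq_left (Set.mem_Ioi.1 hz).le]
      rw [max_eq_left h.le]
      simpa using (hasDerivAt_pow (n + 2) y).congr_of_eventuallyEq h1
  exact hasDerivAt_of_hasDerivAt_of_ne' key (by fun_prop) (by fun_prop) x

section Ampl

variable {ρ s₀ s : ℝ}

theorem gapBelow_nonneg : 0 ≤ gapBelow s₀ s := le_max_right _ _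

theorem gapBelow_le (hs : 0 < s₀) : gapBelow s₀ s ≤ s₀ :=
  max_le (by linarith [abs_nonneg s]) hs.le

theorem gapBelow_lt (hs : 0 < s₀) (h : s ≠ 0) : gapBelow s₀ s < s₀ :=
  max_lt (by linarith [abs_pos.2 h]) hs

theorem continuous_gapBelow : Continuous (gapBelow s₀) := by unfold gapBelow; fun_prop

theorem gapBelow_neg : gapBelow s₀ (-s) = gapBelow s₀ s := by simp [gapBelow]

theorem gapBelow_of_le (h : s₀ ≤ s) : gapBelow s₀ s = 0 :=
  max_eq_right (by linarith [le_abs_self s])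

theorem ampl_neg : ampl ρ s₀ (-s) = ampl ρ s₀ s := by simp [ampl, gapBelow_neg]

theorem amplLog_neg : amplLog ρ s₀ (-s) = amplLog ρ s₀ s := by simp [amplLog, gapBelow_neg]

theorem ampl_base_nonneg (hs : 0 < s₀) : 0 ≤ s₀ ^ 2 - gapBelow s₀ s ^ 2 := by
  have h1 := gapBelow_le (s := s) hs
  have h2 := gapBelow_nonneg (s₀ := s₀) (s := s)
  nlinarith

theorem ampl_base_pos (hs : 0 < s₀) (h : s ≠ 0) : 0 < s₀ ^ 2 - gapBelow s₀ s ^ 2 := by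
  have h1 := gapBelow_lt hs h
  have h2 := gapBelow_nonneg (s₀ := s₀) (s := s)
  nlinarith

theorem ampl_nonneg (hs : 0 < s₀) : 0 ≤ ampl ρ s₀ s := Real.rpow_nonneg (ampl_base_nonneg hs) _

theorem ampl_pos (hs : 0 < s₀) (h : s ≠ 0) : 0 < ampl ρ s₀ s :=
  Real.rpow_pos_of_pos (ampl_base_pos hs h) _

theorem continuous_ampl (hρ : 0 < ρ) : Continuous (ampl ρ s₀) :=
  (continuous_const.sub (continuous_gapBelow.pow 2)).rpow_const fun _ => Or.inr hρ.le

theorem ampl_le_const (hρ : 0 < ρ) (hs : 0 < s₀) : ampl ρ s₀ s ≤ (s₀ ^ 2) ^ ρ :=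
  Real.rpow_le_rpow (ampl_base_nonneg hs) (by nlinarith [sq_nonneg (gapBelow s₀ s)]) hρ.le

theorem ampl_le_rpow (hρ : 0 < ρ) (hs : 0 < s₀) : ampl ρ s₀ s ≤ (2 * s₀ * |s|) ^ ρ := by
  refine Real.rpow_le_rpow (ampl_base_nonneg hs) ?_ hρ.le
  have h1 : s₀ - |s| ≤ gapBelow s₀ s := le_max_left _ _
  have h2 := gapBelow_le (s := s) hs
  have h3 := gapBelow_nonneg (s₀ := s₀) (s := s)
  nlinarith [abs_nonneg s]

theorem amplLog_nonneg (hρ : 0 < ρ) (hs : 0 < s₀) : 0 ≤ amplLog ρ s₀ s := by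
  have := gapBelow_nonneg (s₀ := s₀) (s := s)
  unfold amplLog; positivity

theorem amplLog_le (hρ : 0 < ρ) (hs : 0 < s₀) : amplLog ρ s₀ s ≤ ρ := by
  have h1 := gapBelow_nonneg (s₀ := s₀) (s := s)
  have h2 := gapBelow_le (s := s) hs
  refine mul_le_of_le_one_right hρ.le ?_
  rw [div_le_one (by positivity)]; linarith

theorem amplLog_of_le (h : s₀ ≤ s) : amplLog ρ s₀ s = 0 := by
  simp [amplLog, gapBelow_of_le h]

theorem continuous_amplLog (hs : 0 < s₀) : Continuous (amplLog ρ s₀) :=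
  continuous_const.mul ((continuous_const.mul continuous_gapBelow).div
    (continuous_const.add continuous_gapBelow) fun s => by
      have := gapBelow_nonneg (s₀ := s₀) (s := s); positivity)

theorem hasDerivAt_ampl (hs : 0 < s₀) (h : 0 < s) :
    HasDerivAt (ampl ρ s₀) (ampl ρ s₀ s * amplLog ρ s₀ s / s) s := by
  have h1 : HasDerivAt (fun x => gapBelow s₀ x ^ 2) (-(2 * gapBelow s₀ s)) s := by
    have h2 := (hasDerivAt_max_zero_pow 0 (s₀ - s)).comp s ((hasDerivAt_id s).const_sub s₀)
    have h3 : (fun x => gapBelow s₀ x ^ 2) =ᶠ[𝓝 s]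
        (fun y : ℝ => max y 0 ^ (0 + 2)) ∘ fun x => s₀ - id x := by
      filter_upwards [Ioi_mem_nhds h] with x hx
      simp [gapBelow, abs_of_pos (Set.mem_Ioi.1 hx)]
    have h4 := h2.congr_of_eventuallyEq h3
    refine h4.congr_deriv ?_
    simp [gapBelow, abs_of_pos h]
  have hb := ampl_base_pos hs h.ne'
  have h5 := (h1.const_sub (s₀ ^ 2)).rpow_const (p := ρ) (Or.inl hb.ne')
  refine HasDerivAt.congr_deriv (f := ampl ρ s₀) h5 ?_
  have hm := gapBelow_nonneg (s₀ := s₀) (s := s)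
  have h6 : gapBelow s₀ s * (s₀ - gapBelow s₀ s) = gapBelow s₀ s * s := by
    rcases le_total s₀ s with h7 | h7
    · simp [gapBelow_of_le h7]
    · have : gapBelow s₀ s = s₀ - s := by
        rw [gapBelow, abs_of_pos h, max_eq_left (by linarith)]
      rw [this]; ring
  have h8 : (s₀ ^ 2 - gapBelow s₀ s ^ 2) ^ ρ =
      (s₀ ^ 2 - gapBelow s₀ s ^ 2) ^ (ρ - 1) * (s₀ ^ 2 - gapBelow s₀ s ^ 2) := by
    rw [← Real.rpow_add_one hb.ne']; ring_nf
  simp only [ampl, amplLog]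
  rw [h8]
  have h9 : 0 < s₀ + gapBelow s₀ s := by positivity
  field_simp
  linear_combination (-ρ * (s₀ + gapBelow s₀ s)) * h6

theorem hasDerivAt_mul_ampl (hρ : 0 < ρ) (hs : 0 < s₀) (s : ℝ) :
    HasDerivAt (fun x => x * ampl ρ s₀ x) (ampl ρ s₀ s * (1 + amplLog ρ s₀ s)) s := by
  have hpos : ∀ s : ℝ, 0 < s →
      HasDerivAt (fun x => x * ampl ρ s₀ x) (ampl ρ s₀ s * (1 + amplLog ρ s₀ s)) s := by
    intro s h
    refine ((hasDerivAt_id' s).mul (hasDerivAt_ampl (ρ := ρ) hs h)).congr_deriv ?_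
    field_simp
  refine hasDerivAt_of_hasDerivAt_of_ne' (x := 0) (fun y hy => ?_)
    (continuous_id.mul (continuous_ampl hρ)).continuousAt
    ((continuous_ampl hρ).mul (continuous_const.add (continuous_amplLog hs))).continuousAt s
  rcases lt_or_gt_of_ne hy with h | h
  · have h1 := ((hpos (-y) (by linarith)).comp y (hasDerivAt_neg y)).neg
    refine (h1.congr_of_eventuallyEq (f₁ := fun x => x * ampl ρ s₀ x) ?_).congr_deriv ?_
    · exact Eventually.of_forall fun x => by simp [ampl_neg]
    · simp [ampl_neg, amplLog_neg]
  · exact hpos y h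

end Ampl

theorem le_of_hasDerivAt_nonneg {F F' : ℝ → ℝ} {a b : ℝ} (hab : a ≤ b)
    (hF : ContinuousOn F (Set.Icc a b))
    (hd : ∀ x, a < x → x < b → HasDerivAt F (F' x) x) (hn : ∀ x, a < x → x < b → 0 ≤ F' x) :
    F a ≤ F b := by
  refine monotoneOn_of_deriv_nonneg (convex_Icc a b) hF ?_ ?_
    (Set.left_mem_Icc.2 hab) (Set.right_mem_Icc.2 hab) hab
  · intro x hx
    rw [interior_Icc] at hx
    exact (hd x hx.1 hx.2).differentiableAt.differentiableWithinAt
  · intro x hx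
    rw [interior_Icc] at hx
    rw [(hd x hx.1 hx.2).deriv]
    exact hn x hx.1 hx.2

/-- The test function `φ = f G(f)` with `G = ampl ρ s₀`. -/
noncomputable def testFun (ρ s₀ : ℝ) (f : ℝ → ℝ) (t : ℝ) : ℝ := f t * ampl ρ s₀ (f t)

/-- The derivative of `testFun ρ s₀ f`, in terms of `f₁ = f'`. -/
noncomputable def testFunDeriv (ρ s₀ : ℝ) (f f₁ : ℝ → ℝ) (t : ℝ) : ℝ :=
  ampl ρ s₀ (f t) * (1 + amplLog ρ s₀ (f t)) * f₁ t

/-- The primitive `∫₀ᵗ φ'²`. -/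
noncomputable def testPrim (ρ s₀ : ℝ) (f f₁ : ℝ → ℝ) (t : ℝ) : ℝ :=
  ∫ x in (0 : ℝ)..t, testFunDeriv ρ s₀ f f₁ x ^ 2

/-- The primitive of `φ φ' - ∫₀ φ'²`. -/
noncomputable def testPot (ρ s₀ : ℝ) (f f₁ : ℝ → ℝ) (t : ℝ) : ℝ :=
  testFun ρ s₀ f t ^ 2 / 2 - ∫ x in (0 : ℝ)..t, testPrim ρ s₀ f f₁ x

theorem integral_zero_neg (F : ℝ → ℝ) (t : ℝ) :
    ∫ x in (0 : ℝ)..(-t), F x = -∫ x in (0 : ℝ)..t, F (-x) := by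
  have := intervalIntegral.integral_comp_neg (a := 0) (b := t) F
  rw [this, neg_zero, intervalIntegral.integral_symm]

namespace OddConvex

variable {f f₁ f₂ : ℝ → ℝ} {ρ s₀ : ℝ}

theorem zero (h : OddConvex f f₁ f₂) : f 0 = 0 := by have := h.odd 0; simp at this; linarith

theorem continuous (h : OddConvex f f₁ f₂) : Continuous f :=
  continuous_iff_continuousAt.2 fun t => (h.hasDerivAt t).continuousAt

theorem deriv_nonneg (h : OddConvex f f₁ f₂) (t : ℝ) : 0 ≤ f₁ t := by
  have hpos : ∀ t, 0 < t → 0 ≤ f₁ t := fun t ht => (h.deriv_pos t ht).le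
  rcases lt_trichotomy t 0 with ht | rfl | ht
  · rw [← h.deriv_even]; exact hpos _ (by linarith)
  · exact ge_of_tendsto (h.continuous_deriv.continuousAt.tendsto.mono_left
      (nhdsWithin_le_nhds (s := Set.Ioi 0)))
      (eventually_mem_nhdsWithin.mono fun t ht => hpos t ht)
  · exact hpos t ht

theorem mono (h : OddConvex f f₁ f₂) {a b : ℝ} (hab : a ≤ b) : f a ≤ f b :=
  le_of_hasDerivAt_nonneg hab h.continuous.continuousOn (fun x _ _ => h.hasDerivAt x)
    fun x _ _ => h.deriv_nonneg x

theorem deriv_mono (h : OddConvex f f₁ f₂) {a b : ℝ} (ha : 0 ≤ a) (hab : a ≤ b) : f₁ a ≤ f₁ b :=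
  le_of_hasDerivAt_nonneg hab h.continuous_deriv.continuousOn
    (fun x hx _ => h.hasDerivAt_deriv x (by linarith))
    fun x hx _ => h.deriv2_nonneg x (by linarith)

theorem nonneg (h : OddConvex f f₁ f₂) {t : ℝ} (ht : 0 ≤ t) : 0 ≤ f t := h.zero ▸ h.mono ht

theorem hasDerivAt_testFun (h : OddConvex f f₁ f₂) (hρ : 0 < ρ) (hs : 0 < s₀) (t : ℝ) :
    HasDerivAt (testFun ρ s₀ f) (testFunDeriv ρ s₀ f f₁ t) t :=
  (hasDerivAt_mul_ampl hρ hs (f t)).comp t (h.hasDerivAt t)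

theorem continuous_testFunDeriv (h : OddConvex f f₁ f₂) (hρ : 0 < ρ) (hs : 0 < s₀) :
    Continuous (testFunDeriv ρ s₀ f f₁) :=
  (((continuous_ampl hρ).comp h.continuous).mul
    (continuous_const.add ((continuous_amplLog hs).comp h.continuous))).mul h.continuous_deriv

theorem hasDerivAt_testPrim (h : OddConvex f f₁ f₂) (hρ : 0 < ρ) (hs : 0 < s₀) (t : ℝ) :
    HasDerivAt (testPrim ρ s₀ f f₁) (testFunDeriv ρ s₀ f f₁ t ^ 2) t :=
  ((h.continuous_testFunDeriv hρ hs).pow 2).integral_hasStrictDerivAt 0 t |>.hasDerivAt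

theorem continuous_testPrim (h : OddConvex f f₁ f₂) (hρ : 0 < ρ) (hs : 0 < s₀) :
    Continuous (testPrim ρ s₀ f f₁) :=
  continuous_iff_continuousAt.2 fun t => (h.hasDerivAt_testPrim hρ hs t).continuousAt

theorem hasDerivAt_testPot (h : OddConvex f f₁ f₂) (hρ : 0 < ρ) (hs : 0 < s₀) (t : ℝ) :
    HasDerivAt (testPot ρ s₀ f f₁)
      (testFun ρ s₀ f t * testFunDeriv ρ s₀ f f₁ t - testPrim ρ s₀ f f₁ t) t := by
  have h1 := ((h.hasDerivAt_testFun hρ hs t).pow 2).div_const 2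
  have h2 := ((h.continuous_testPrim hρ hs).integral_hasStrictDerivAt 0 t).hasDerivAt
  refine (h1.sub h2).congr_deriv ?_
  norm_num
  ring

theorem testFun_neg (h : OddConvex f f₁ f₂) (t : ℝ) :
    testFun ρ s₀ f (-t) = -testFun ρ s₀ f t := by
  simp [testFun, h.odd, ampl_neg]

theorem testFunDeriv_neg (h : OddConvex f f₁ f₂) (t : ℝ) :
    testFunDeriv ρ s₀ f f₁ (-t) = testFunDeriv ρ s₀ f f₁ t := by
  simp [testFunDeriv, h.odd, h.deriv_even, ampl_neg, amplLog_neg]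

theorem testPrim_neg (h : OddConvex f f₁ f₂) (t : ℝ) :
    testPrim ρ s₀ f f₁ (-t) = -testPrim ρ s₀ f f₁ t := by
  simp only [testPrim, integral_zero_neg, h.testFunDeriv_neg]

theorem testPot_neg (h : OddConvex f f₁ f₂) (t : ℝ) :
    testPot ρ s₀ f f₁ (-t) = testPot ρ s₀ f f₁ t := by
  simp only [testPot, integral_zero_neg, h.testPrim_neg, h.testFun_neg,
    intervalIntegral.integral_neg]
  ring

theorem testPrim_nonneg {t : ℝ} (ht : 0 ≤ t) : 0 ≤ testPrim ρ s₀ f f₁ t :=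
  intervalIntegral.integral_nonneg ht fun _ _ => sq_nonneg _

theorem hasDerivAt_energy (h : OddConvex f f₁ f₂) (hs : 0 < s₀) {t : ℝ} (ht : 0 < t) :
    HasDerivAt (fun t => f₁ t * f t * ampl ρ s₀ (f t) ^ 2)
      (ampl ρ s₀ (f t) ^ 2 * (f t * f₂ t + f₁ t ^ 2 * (1 + 2 * amplLog ρ s₀ (f t)))) t := by
  have hf := h.pos t ht
  have h1 := ((hasDerivAt_ampl (ρ := ρ) hs hf).comp t (h.hasDerivAt t)).pow 2
  refine (((h.hasDerivAt_deriv t ht).mul (h.hasDerivAt t)).mul h1).congr_deriv ?_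
  simp only [Function.comp, Pi.mul_apply, Pi.pow_apply]
  field_simp
  norm_num
  ring

/-- Coercivity: `f' φ² / f - ∫ φ'²` controls a positive multiple of `f' φ² / f`. -/
theorem exists_coercive (h : OddConvex f f₁ f₂) (hρ : 0 < ρ) (hρ1 : ρ ≤ 1) {κ t₀ t₁ n : ℝ}
    (hκ : ρ ^ 2 < κ) (hκ1 : κ ≤ 1) (ht₀ : 0 < t₀) (ht₁ : t₀ ≤ t₁) (hn : 0 ≤ n)
    (hlow : ∀ t, 0 < t → t < t₀ → κ * f₁ t ^ 2 ≤ f t * f₂ t)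
    (hinf : ∀ t, t₁ < t → f₁ t ^ 2 ≤ n * (f t * f₂ t)) :
    ∃ c, 0 < c ∧ ∀ t, 0 ≤ t → c * (f₁ t * f t * ampl ρ (f t₀) (f t) ^ 2) ≤
      f₁ t * f t * ampl ρ (f t₀) (f t) ^ 2 - testPrim ρ (f t₀) f f₁ t := by
  have hs : 0 < f t₀ := h.pos t₀ ht₀
  set s₀ := f t₀ with hs₀
  set E : ℝ → ℝ := fun t => f₁ t * f t * ampl ρ s₀ (f t) ^ 2 with hE
  set ψ := testPrim ρ s₀ f f₁ with hψ
  have hEc : Continuous E := (h.continuous_deriv.mul h.continuous).mul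
    (((continuous_ampl hρ).comp h.continuous).pow 2)
  have hψc : Continuous ψ := h.continuous_testPrim hρ hs
  have hEpos : ∀ t, 0 < t → 0 < E t := fun t ht => by
    have h1 := h.deriv_pos t ht
    have h2 := h.pos t ht
    have h3 := ampl_pos (ρ := ρ) hs h2.ne'
    positivity
  have hE0 : E 0 = 0 := by simp [hE, h.zero]
  have hψ0 : ψ 0 = 0 := by simp [hψ, testPrim]
  have hEd : ∀ t, 0 < t → HasDerivAt E
      (ampl ρ s₀ (f t) ^ 2 * (f t * f₂ t + f₁ t ^ 2 * (1 + 2 * amplLog ρ s₀ (f t)))) t :=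
    fun t ht => h.hasDerivAt_energy hs ht
  have hd : ∀ (c t : ℝ), 0 < t → HasDerivAt (fun t => E t - ψ t - c * E t)
      (ampl ρ s₀ (f t) ^ 2 * (f t * f₂ t - f₁ t ^ 2 * amplLog ρ s₀ (f t) ^ 2 -
        c * (f t * f₂ t + f₁ t ^ 2 * (1 + 2 * amplLog ρ s₀ (f t))))) t := by
    intro c t ht
    refine (((hEd t ht).sub (h.hasDerivAt_testPrim hρ hs t)).sub
      ((hEd t ht).const_mul c)).congr_deriv ?_
    simp only [testFunDeriv]
    ring
  have hcont : ∀ c : ℝ, Continuous fun t => E t - ψ t - c * E t := fun c => by fun_prop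
  have hEt₀ := hEpos t₀ ht₀
  have hEt₁ := hEpos t₁ (by linarith)
  set c₀ := (κ - ρ ^ 2) / 4 with hc₀
  have hc₀pos : 0 < c₀ := by rw [hc₀]; linarith
  set c := min c₀ (min (c₀ * E t₀ / E t₁) (1 / (1 + n))) with hc
  have hcpos : 0 < c := by positivity
  have hc1 : c ≤ c₀ := min_le_left _ _
  have hc2 : c * E t₁ ≤ c₀ * E t₀ := by
    rw [← le_div_iff₀ hEt₁]; exact (min_le_right _ _).trans (min_le_left _ _)
  have hc3 : c * (1 + n) ≤ 1 := by
    rw [← le_div_iff₀ (by linarith)]; exact (min_le_right _ _).trans (min_le_right _ _)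
  have hb0 : ∀ t, t₀ ≤ t → amplLog ρ s₀ (f t) = 0 := fun t ht => amplLog_of_le (h.mono ht)
  have near : ∀ c, 0 < c → c ≤ c₀ → ∀ t, 0 ≤ t → t ≤ t₀ → 0 ≤ E t - ψ t - c * E t := by
    intro c hc hc1 t ht htt
    have h1 := le_of_hasDerivAt_nonneg ht (hcont c).continuousOn
        (fun x hx _ => hd c x hx) ?_
    · simpa [hE0, hψ0] using h1
    · intro x hx hxt
      refine mul_nonneg (sq_nonneg _) ?_
      have hP := hlow x hx (by linarith)
      have hb := amplLog_le (s := f x) hρ hs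
      have hbn := amplLog_nonneg (s := f x) hρ hs
      set b := amplLog ρ s₀ (f x)
      set P := f x * f₂ x
      have hQ : 0 ≤ f₁ x ^ 2 := sq_nonneg _
      set Q := f₁ x ^ 2
      have hb2 : b ^ 2 ≤ ρ ^ 2 := by nlinarith
      have e1 : Q * b ^ 2 ≤ Q * ρ ^ 2 := mul_le_mul_of_nonneg_left hb2 hQ
      have e2 : c * (Q * (1 + 2 * b)) ≤ c * (Q * 3) := by gcongr; linarith
      have e3 : c ≤ 1 := by nlinarith [sq_nonneg ρ]
      have e4 : κ * Q * (1 - c) ≤ P * (1 - c) := mul_le_mul_of_nonneg_right hP (by linarith)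
      have e5 : κ * (Q * c) ≤ 1 * (Q * c) := mul_le_mul_of_nonneg_right hκ1 (by positivity)
      have e6 : Q * (4 * c) ≤ Q * (κ - ρ ^ 2) := mul_le_mul_of_nonneg_left (by linarith) hQ
      nlinarith
  have middle : ∀ t, t₀ ≤ t → t ≤ t₁ → 0 ≤ E t - ψ t - c * E t := by
    intro t ht htt
    have h0 := near c₀ hc₀pos le_rfl t₀ ht₀.le le_rfl
    have h1 := le_of_hasDerivAt_nonneg ht (hcont 0).continuousOn
        (fun x hx _ => hd 0 x (by linarith)) ?_
    · have h2 := le_of_hasDerivAt_nonneg htt hEc.continuousOn (fun x hx _ => hEd x (by linarith)) ?_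
      · have h3 : c * E t ≤ c * E t₁ := by gcongr
        simp only [zero_mul] at h1
        linarith
      · intro x hx hxt
        rw [hb0 x (by linarith)]
        have := h.pos x (by linarith)
        have := h.deriv2_nonneg x (by linarith)
        positivity
    · intro x hx hxt
      rw [hb0 x (by linarith)]
      have := h.pos x (by linarith)
      have := h.deriv2_nonneg x (by linarith)
      simp only [ne_eq, OfNat.ofNat_ne_zero, not_false_eq_true, zero_pow, mul_zero, sub_zero,
        zero_mul]
      positivity
  have far : ∀ t, t₁ ≤ t → 0 ≤ E t - ψ t - c * E t := by
    intro t ht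
    have h0 := middle t₁ ht₁ le_rfl
    have h1 := le_of_hasDerivAt_nonneg ht (hcont c).continuousOn
        (fun x hx _ => hd c x (by linarith)) ?_
    · exact h0.trans h1
    · intro x hx hxt
      rw [hb0 x (by linarith)]
      refine mul_nonneg (sq_nonneg _) ?_
      have h2 := hinf x hx
      have h3 : 0 ≤ f x * f₂ x :=
        mul_nonneg (h.pos x (by linarith)).le (h.deriv2_nonneg x (by linarith))
      have h4 : c * f₁ x ^ 2 ≤ c * (n * (f x * f₂ x)) := by gcongr
      have h5 : c * (1 + n) * (f x * f₂ x) ≤ 1 * (f x * f₂ x) := by gcongr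
      simp only [ne_eq, OfNat.ofNat_ne_zero, not_false_eq_true, zero_pow, mul_zero, sub_zero,
        add_zero, mul_one]
      nlinarith
  refine ⟨c, hcpos, fun t ht => ?_⟩
  have h1 : 0 ≤ E t - ψ t - c * E t := by
    rcases le_total t t₀ with h1 | h1
    · exact near c hcpos hc1 t ht h1
    · rcases le_total t t₁ with h2 | h2
      · exact middle t h1 h2
      · exact far t h2
  have : c * E t ≤ E t - ψ t := by linarith
  exact this

theorem log_comb_hasDerivAt (h : OddConvex f f₁ f₂) (a b : ℝ) {t : ℝ} (ht : 0 < t) :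
    HasDerivAt (fun t => a * Real.log (f t) + b * Real.log (f₁ t))
      ((a * f₁ t ^ 2 + b * (f t * f₂ t)) / (f t * f₁ t)) t := by
  have h1 := h.pos t ht
  have h2 := h.deriv_pos t ht
  refine ((((h.hasDerivAt t).log h1.ne').const_mul a).add
    (((h.hasDerivAt_deriv t ht).log h2.ne').const_mul b)).congr_deriv ?_
  field_simp

theorem log_comb_le (h : OddConvex f f₁ f₂) (a b : ℝ) {t t' : ℝ} (ht : 0 < t) (htt : t ≤ t')
    (hn : ∀ x, t < x → x < t' → 0 ≤ a * f₁ x ^ 2 + b * (f x * f₂ x)) :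
    a * Real.log (f t) + b * Real.log (f₁ t) ≤ a * Real.log (f t') + b * Real.log (f₁ t') :=
  le_of_hasDerivAt_nonneg htt
    (fun _ hx => (h.log_comb_hasDerivAt a b (ht.trans_le hx.1)).continuousAt.continuousWithinAt)
    (fun _ hx _ => h.log_comb_hasDerivAt a b (ht.trans hx)) fun x hx hx' =>
      div_nonneg (hn x hx hx') (mul_pos (h.pos x (ht.trans hx)) (h.deriv_pos x (ht.trans hx))).le

theorem rpow_le_deriv_near_zero (h : OddConvex f f₁ f₂) {a t₀ : ℝ}
    (hup : ∀ t, 0 < t → t < t₀ → f t * f₂ t ≤ a * f₁ t ^ 2) :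
    ∃ C, 0 < C ∧ ∀ t, 0 < t → t ≤ t₀ → f t ^ a ≤ C * f₁ t := by
  refine ⟨Real.exp (a * Real.log (f t₀) + (-1) * Real.log (f₁ t₀)), Real.exp_pos _,
    fun t ht htt => ?_⟩
  have h1 := h.log_comb_le a (-1) ht htt fun x hx hx' => by
    have := hup x (ht.trans hx) hx'; linarith
  rw [Real.rpow_def_of_pos (h.pos t ht), ← Real.exp_log (h.deriv_pos t ht), ← Real.exp_add]
  exact Real.exp_le_exp.2 (by linarith)

theorem le_deriv_pow_near_top (h : OddConvex f f₁ f₂) {t₀ t₁ : ℝ} {n : ℕ} (ht₀ : 0 < t₀)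
    (ht₁ : t₀ ≤ t₁) (hinf : ∀ t, t₁ < t → f₁ t ^ 2 ≤ n * (f t * f₂ t)) :
    ∃ C, 0 < C ∧ ∀ t, t₀ ≤ t → f t ≤ C * f₁ t ^ n := by
  have hp₁ : 0 < t₁ := by linarith
  set A := Real.exp (Real.log (f t₁) + -n * Real.log (f₁ t₁)) with hA
  have hf₀ := h.deriv_pos t₀ ht₀
  have hft := h.pos t₁ hp₁
  refine ⟨A + f t₁ / f₁ t₀ ^ n, by positivity, fun t ht => ?_⟩
  have htp : 0 < t := by linarith
  have hf₁ := h.deriv_pos t htp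
  rcases le_total t t₁ with h1 | h1
  · calc f t ≤ f t₁ := h.mono h1
      _ = f t₁ / f₁ t₀ ^ n * f₁ t₀ ^ n := by field_simp
      _ ≤ f t₁ / f₁ t₀ ^ n * f₁ t ^ n := by
        gcongr; exact h.deriv_mono ht₀.le ht
      _ ≤ _ := by gcongr; linarith [Real.exp_pos (Real.log (f t₁) + -n * Real.log (f₁ t₁))]
  · have h2 := h.log_comb_le (-1) n hp₁ h1 fun x hx _ => by
      have := hinf x hx; linarith
    calc f t = Real.exp (Real.log (f t)) := (Real.exp_log (h.pos t htp)).symm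
      _ ≤ Real.exp ((Real.log (f t₁) + -n * Real.log (f₁ t₁)) + n * Real.log (f₁ t)) :=
        Real.exp_le_exp.2 (by linarith)
      _ = A * f₁ t ^ n := by
        rw [Real.exp_add, mul_comm (n : ℝ) (Real.log (f₁ t)), Real.exp_mul, Real.exp_log hf₁,
          Real.rpow_natCast]
      _ ≤ _ := by gcongr; linarith [div_pos hft (pow_pos hf₀ n)]

theorem exists_growth (h : OddConvex f f₁ f₂) (hρ : 0 < ρ) {a t₀ t₁ : ℝ} {n : ℕ} (ha : 0 < a)
    (ht₀ : 0 < t₀) (ht₁ : t₀ ≤ t₁)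
    (hup : ∀ t, 0 < t → t < t₀ → f t * f₂ t ≤ a * f₁ t ^ 2)
    (hinf : ∀ t, t₁ < t → f₁ t ^ 2 ≤ n * (f t * f₂ t)) :
    ∃ C, 0 < C ∧ ∀ t, 0 < t →
      testFun ρ (f t₀) f t ^ 2 ≤ C * (f₁ t ^ (2 * (1 + ρ) / a) + f₁ t ^ (2 * n)) := by
  have hs : 0 < f t₀ := h.pos t₀ ht₀
  obtain ⟨A, hA, hA'⟩ := h.rpow_le_deriv_near_zero hup
  obtain ⟨B, hB, hB'⟩ := h.le_deriv_pow_near_top ht₀ ht₁ hinf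
  set s₀ := f t₀
  set p := (1 + ρ) / a with hp
  have hp0 : 0 < p := by positivity
  refine ⟨((2 * s₀) ^ ρ * A ^ p) ^ 2 + ((s₀ ^ 2) ^ ρ * B) ^ 2, by positivity, fun t ht => ?_⟩
  have hf := h.pos t ht
  have hf₁ := h.deriv_pos t ht
  have hG := ampl_nonneg (ρ := ρ) (s := f t) hs
  rcases le_total t t₀ with h1 | h1
  · have h2 : testFun ρ s₀ f t ≤ (2 * s₀) ^ ρ * A ^ p * f₁ t ^ p := by
      calc testFun ρ s₀ f t ≤ f t * (2 * s₀ * |f t|) ^ ρ := by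
            unfold testFun; gcongr; exact ampl_le_rpow hρ hs
        _ = (2 * s₀) ^ ρ * (f t ^ a) ^ p := by
            rw [abs_of_pos hf, Real.mul_rpow (by positivity) hf.le, ← Real.rpow_mul hf.le, hp,
              mul_div_cancel₀ _ ha.ne', Real.rpow_add hf, Real.rpow_one]
            ring
        _ ≤ (2 * s₀) ^ ρ * (A * f₁ t) ^ p := by
            gcongr; exact hA' t ht h1
        _ = _ := by rw [Real.mul_rpow hA.le hf₁.le]; ring
    have h3 : f₁ t ^ (2 * (1 + ρ) / a) = (f₁ t ^ p) ^ 2 := by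
      rw [← Real.rpow_natCast (f₁ t ^ p), ← Real.rpow_mul hf₁.le, hp]
      congr 1; push_cast; ring
    rw [h3]
    calc testFun ρ s₀ f t ^ 2 ≤ ((2 * s₀) ^ ρ * A ^ p * f₁ t ^ p) ^ 2 := by
          gcongr; exact mul_nonneg hf.le hG
      _ = ((2 * s₀) ^ ρ * A ^ p) ^ 2 * (f₁ t ^ p) ^ 2 := by ring
      _ ≤ _ := by
          gcongr
          · exact le_add_of_nonneg_right (by positivity)
          · exact le_add_of_nonneg_right (by positivity)
  · have h2 : testFun ρ s₀ f t ≤ (s₀ ^ 2) ^ ρ * B * f₁ t ^ n := by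
      calc testFun ρ s₀ f t ≤ (B * f₁ t ^ n) * (s₀ ^ 2) ^ ρ := by
            unfold testFun
            exact mul_le_mul (hB' t h1) (ampl_le_const hρ hs) hG (by positivity)
        _ = _ := by ring
    calc testFun ρ s₀ f t ^ 2 ≤ ((s₀ ^ 2) ^ ρ * B * f₁ t ^ n) ^ 2 := by
          gcongr; exact mul_nonneg hf.le hG
      _ = ((s₀ ^ 2) ^ ρ * B) ^ 2 * f₁ t ^ (2 * n) := by ring
      _ ≤ _ := by
          gcongr
          · exact le_add_of_nonneg_left (by positivity)
          · exact le_add_of_nonneg_left (by positivity)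

end OddConvex

/-- Functions `φ`, `φ'`, `ψ = ∫ φ'²` and a primitive `H` of `φ φ' - ψ`, such that testing
stability with `φ(u)` and the equation with `ψ(u)` yields a coercive integral estimate. -/
structure StabilityWeights (f f₁ φ φ₁ ψ H : ℝ → ℝ) (c C s : ℝ) (n : ℕ) : Prop where
  c_pos : 0 < c
  C_pos : 0 < C
  continuous_deriv : Continuous φ₁
  hasDerivAt : ∀ t, HasDerivAt φ (φ₁ t) t
  hasDerivAt_prim : ∀ t, HasDerivAt ψ (φ₁ t ^ 2) t
  hasDerivAt_pot : ∀ t, HasDerivAt H (φ t * φ₁ t - ψ t) t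
  pot_nonneg : ∀ t, 0 ≤ H t
  pot_le : ∀ t, H t ≤ φ t ^ 2 / 2
  coercive : ∀ t, c * (f₁ t * φ t ^ 2) ≤ f₁ t * φ t ^ 2 - f t * ψ t
  growth : ∀ t, φ t ^ 2 ≤ C * (f₁ t ^ s + f₁ t ^ n)
  ne_zero : ∀ t, t ≠ 0 → φ t ≠ 0

theorem OddConvex.exists_stabilityWeights {f f₁ f₂ : ℝ → ℝ} (h : OddConvex f f₁ f₂)
    {ρ κ a t₀ t₁ : ℝ} {n : ℕ} (hρ : 0 < ρ) (hρ1 : ρ ≤ 1) (hκ : ρ ^ 2 < κ) (hκ1 : κ ≤ 1)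
    (ha : 0 < a) (ht₀ : 0 < t₀) (ht₁ : t₀ ≤ t₁)
    (hlow : ∀ t, 0 < t → t < t₀ → κ * f₁ t ^ 2 ≤ f t * f₂ t)
    (hup : ∀ t, 0 < t → t < t₀ → f t * f₂ t ≤ a * f₁ t ^ 2)
    (hinf : ∀ t, t₁ < t → f₁ t ^ 2 ≤ n * (f t * f₂ t)) :
    ∃ (φ φ₁ ψ H : ℝ → ℝ) (c C : ℝ),
      StabilityWeights f f₁ φ φ₁ ψ H c C (2 * (1 + ρ) / a) (2 * n) := by
  obtain ⟨c, hc, hc'⟩ := h.exists_coercive hρ hρ1 hκ hκ1 ht₀ ht₁ n.cast_nonneg hlow hinf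
  obtain ⟨C, hC, hC'⟩ := h.exists_growth hρ ha ht₀ ht₁ hup hinf
  have hs : 0 < f t₀ := h.pos t₀ ht₀
  have even_ext : ∀ P : ℝ → Prop, (∀ t, P (-t) → P t) → (∀ t, 0 ≤ t → P t) → ∀ t, P t := by
    intro P h1 h2 t
    rcases le_total 0 t with h3 | h3
    · exact h2 t h3
    · exact h1 t (h2 _ (by linarith))
  have hψ : ∀ t, 0 ≤ t → 0 ≤ ∫ x in (0 : ℝ)..t, testPrim ρ (f t₀) f f₁ x := fun t ht =>
    intervalIntegral.integral_nonneg ht fun x hx => OddConvex.testPrim_nonneg hx.1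
  refine ⟨testFun ρ (f t₀) f, testFunDeriv ρ (f t₀) f f₁, testPrim ρ (f t₀) f f₁,
    testPot ρ (f t₀) f f₁, c, C, hc, hC, h.continuous_testFunDeriv hρ hs,
    h.hasDerivAt_testFun hρ hs, h.hasDerivAt_testPrim hρ hs, h.hasDerivAt_testPot hρ hs,
    ?_, ?_, ?_, ?_, ?_⟩
  · refine even_ext _ (fun t ht => by rwa [h.testPot_neg] at ht) fun t ht => ?_
    have h0 : testPot ρ (f t₀) f f₁ 0 = 0 := by simp [testPot, testFun, h.zero]
    rw [← h0]
    refine le_of_hasDerivAt_nonneg ht (fun x _ =>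
      (h.hasDerivAt_testPot hρ hs x).continuousAt.continuousWithinAt)
      (fun x _ _ => h.hasDerivAt_testPot hρ hs x) fun x hx _ => ?_
    have h1 := hc' x hx.le
    have h2 := h.nonneg hx.le
    have h3 := h.deriv_nonneg x
    have h4 := amplLog_nonneg (s := f x) hρ hs
    have h5 : 0 ≤ f₁ x * f x * ampl ρ (f t₀) (f x) ^ 2 := by positivity
    have h6 : testFun ρ (f t₀) f x * testFunDeriv ρ (f t₀) f f₁ x =
        f₁ x * f x * ampl ρ (f t₀) (f x) ^ 2 * (1 + amplLog ρ (f t₀) (f x)) := by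
      simp only [testFun, testFunDeriv]; ring
    rw [h6]
    have h7 := mul_nonneg h5 h4
    have h8 := mul_nonneg hc.le h5
    linarith
  · refine even_ext _ (fun t ht => by simpa [h.testPot_neg, h.testFun_neg] using ht)
      fun t ht => ?_
    have := hψ t ht
    simp only [testPot]
    linarith
  · refine even_ext _ (fun t ht => by
      simpa [h.deriv_even, h.odd, h.testFun_neg, h.testPrim_neg] using ht) fun t ht => ?_
    have h1 := mul_le_mul_of_nonneg_left (hc' t ht) (h.nonneg ht)
    simp only [testFun]
    linarith
  · refine even_ext _ (fun t ht => by
      simpa only [h.testFun_neg, h.deriv_even, neg_sq] using ht) fun t ht => ?_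
    rcases ht.eq_or_lt with rfl | ht
    · have h1 := h.deriv_nonneg 0
      have : testFun ρ (f t₀) f 0 ^ 2 = 0 := by simp [testFun, h.zero]
      rw [this]; positivity
    · exact hC' t ht
  · intro t ht
    have h1 : f t ≠ 0 := by
      rcases lt_or_gt_of_ne ht with h1 | h1
      · have := h.pos (-t) (by linarith)
        rw [h.odd] at this; linarith
      · exact (h.pos t h1).ne'
    exact mul_ne_zero h1 (ampl_pos hs h1).ne'

theorem norm_gradient_sq {N : ℕ} (F : EuclideanSpace ℝ (Fin N) → ℝ)
    (x : EuclideanSpace ℝ (Fin N)) :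
    ‖gradient F x‖ ^ 2 = ∑ i, fderiv ℝ F x (EuclideanSpace.single i 1) ^ 2 := by
  rw [EuclideanSpace.real_norm_sq_eq]
  refine Finset.sum_congr rfl fun i _ => ?_
  congr 1
  have h1 : inner ℝ (gradient F x) (EuclideanSpace.single i (1 : ℝ)) =
      fderiv ℝ F x (EuclideanSpace.single i 1) := by simp [gradient]
  rw [← h1, EuclideanSpace.inner_single_right]
  simp

theorem integral_fderiv_apply_eq_zero {N : ℕ} {F : EuclideanSpace ℝ (Fin N) → ℝ}
    (hF : ContDiff ℝ 1 F) (hc : HasCompactSupport F) (v : EuclideanSpace ℝ (Fin N)) :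
    ∫ x, fderiv ℝ F x v = 0 := by
  have hd : Integrable fun x => fderiv ℝ F x v :=
    ((hF.continuous_fderiv (by norm_num)).clm_apply
      continuous_const).integrable_of_hasCompactSupport
      (hc.fderiv_apply (𝕜 := ℝ) v)
  have h := integral_mul_fderiv_eq_neg_fderiv_mul_of_integrable (μ := volume)
    (f := fun _ : EuclideanSpace ℝ (Fin N) => (1 : ℝ)) (g := F) (v := v) (by simp)
    (by simpa using hd) (by simpa using hF.continuous.integrable_of_hasCompactSupport hc)
    (fun _ _ => by fun_prop) (fun x _ => hF.differentiable (by norm_num) x)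
  simpa using h

/-- The Lipschitz cutoff `(1 - |x|² / R²)₊`, whose powers serve as cutoff functions. -/
noncomputable def ballCut {N : ℕ} (R : ℝ) (x : EuclideanSpace ℝ (Fin N)) : ℝ :=
  max (1 - ‖x‖ ^ 2 / R ^ 2) 0

section BallCut

variable {N : ℕ} {R : ℝ} {x : EuclideanSpace ℝ (Fin N)}

theorem ballCut_nonneg : 0 ≤ ballCut R x := le_max_right _ _

theorem ballCut_le_one : ballCut R x ≤ 1 :=
  max_le (by linarith [show (0 : ℝ) ≤ ‖x‖ ^ 2 / R ^ 2 by positivity]) zero_le_one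

theorem continuous_ballCut : Continuous (ballCut (N := N) R) := by unfold ballCut; fun_prop

theorem norm_lt_of_ballCut_ne_zero (hR : 0 < R) (h : ballCut R x ≠ 0) : ‖x‖ < R := by
  by_contra! h1
  refine h (max_eq_right ?_)
  have : 1 ≤ ‖x‖ ^ 2 / R ^ 2 := by
    rw [one_le_div (by positivity)]; gcongr
  linarith

theorem ballCut_pos (h : ‖x‖ < R) : 0 < ballCut R x := by
  have hR : 0 < R := (norm_nonneg x).trans_lt h
  refine lt_max_of_lt_left ?_
  have : ‖x‖ ^ 2 / R ^ 2 < 1 := by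
    rw [div_lt_one (by positivity)]; gcongr
  linarith

theorem ballCut_mono {R' : ℝ} (hR : 0 < R) (h : R ≤ R') : ballCut R x ≤ ballCut R' x := by
  unfold ballCut; gcongr

theorem hasCompactSupport_ballCut (hR : 0 < R) : HasCompactSupport (ballCut (N := N) R) :=
  HasCompactSupport.intro (isCompact_closedBall 0 R) fun x hx => by
    by_contra h
    exact hx (by simpa using (norm_lt_of_ballCut_ne_zero hR h).le)

theorem hasCompactSupport_mul_ballCut_pow (hR : 0 < R) (F : EuclideanSpace ℝ (Fin N) → ℝ)
    {k : ℕ} (hk : k ≠ 0) : HasCompactSupport fun x => F x * ballCut R x ^ k :=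
  HasCompactSupport.mul_left (HasCompactSupport.comp_left (g := fun t : ℝ => t ^ k)
    (hasCompactSupport_ballCut hR) (zero_pow hk))

theorem contDiff_max_zero_pow (k : ℕ) : ContDiff ℝ 1 fun y : ℝ => max y 0 ^ (k + 2) := by
  rw [contDiff_one_iff_deriv]
  refine ⟨fun y => (hasDerivAt_max_zero_pow k y).differentiableAt, ?_⟩
  rw [funext fun y => (hasDerivAt_max_zero_pow k y).deriv]
  fun_prop

theorem contDiff_ballCut_pow (k : ℕ) : ContDiff ℝ 1 fun x => ballCut (N := N) R x ^ (k + 2) :=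
  (contDiff_max_zero_pow k).comp
    (contDiff_const.sub ((contDiff_norm_sq ℝ).div_const _))

theorem hasFDerivAt_ballCut_pow (k : ℕ) (x : EuclideanSpace ℝ (Fin N)) :
    HasFDerivAt (fun x => ballCut (N := N) R x ^ (k + 2))
      ((-((k + 2) * ballCut R x ^ (k + 1) * (2 / R ^ 2))) • innerSL ℝ x) x := by
  have h1 : HasFDerivAt (fun x : EuclideanSpace ℝ (Fin N) => 1 - ‖x‖ ^ 2 / R ^ 2)
      (-((2 / R ^ 2) • innerSL ℝ x)) x := by
    have h2 := ((hasStrictFDerivAt_norm_sq x).hasFDerivAt.mul_const ((R ^ 2)⁻¹)).const_sub 1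
    refine HasFDerivAt.congr_fderiv (f := fun x : EuclideanSpace ℝ (Fin N) =>
      1 - ‖x‖ ^ 2 / R ^ 2) h2 ?_
    ext v
    simp
    ring
  refine HasFDerivAt.congr_fderiv (f := fun x => ballCut (N := N) R x ^ (k + 2))
    ((hasDerivAt_max_zero_pow k _).comp_hasFDerivAt x h1) ?_
  ext v
  simp [ballCut]
  ring

end BallCut

theorem lap_eq {N : ℕ} {u : EuclideanSpace ℝ (Fin N) → ℝ} (hu : ContDiff ℝ 2 u)
    (x : EuclideanSpace ℝ (Fin N)) :
    lap u x = ∑ i, fderiv ℝ (fun y => fderiv ℝ u y (EuclideanSpace.single i 1)) x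
      (EuclideanSpace.single i 1) := by
  refine Finset.sum_congr rfl fun i _ => ?_
  have hd : DifferentiableAt ℝ (fderiv ℝ u) x :=
    (hu.fderiv_right (m := 1) (by norm_num)).differentiable (by norm_num) x
  rw [iteratedFDeriv_two_apply, fderiv_clm_apply hd (by fun_prop)]
  simp

theorem integrable_norm_gradient_sq {N : ℕ} {F : EuclideanSpace ℝ (Fin N) → ℝ}
    (hF : ContDiff ℝ 1 F) (hc : HasCompactSupport F) :
    Integrable fun x => ‖gradient F x‖ ^ 2 := by
  simp only [norm_gradient_sq]
  simp only [pow_two]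
  refine integrable_finsetSum _ fun i _ => ?_
  have h1 : Continuous fun x => fderiv ℝ F x (EuclideanSpace.single i 1) :=
    (hF.continuous_fderiv (by norm_num)).clm_apply continuous_const
  exact (h1.mul h1).integrable_of_hasCompactSupport
    ((hc.fderiv_apply (𝕜 := ℝ) (EuclideanSpace.single i 1)).mul_left)

theorem integral_le_add_of_le {α : Type*} [MeasurableSpace α] {μ : Measure α}
    {F G₁ G₂ G₃ : α → ℝ} (hF : Integrable F μ) (h₁ : Integrable G₁ μ) (h₂ : Integrable G₂ μ)
    (h₃ : Integrable G₃ μ) (h : ∀ x, F x ≤ G₁ x + G₂ x + G₃ x) :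
    ∫ x, F x ∂μ ≤ ∫ x, G₁ x ∂μ + ∫ x, G₂ x ∂μ + ∫ x, G₃ x ∂μ := by
  have h12 : Integrable (fun x => G₁ x + G₂ x) μ := h₁.add h₂
  rw [← integral_add h₁ h₂, ← integral_add h12 h₃]
  exact integral_mono hF (h12.add h₃) h

namespace StabilityWeights

variable {f f₁ φ φ₁ ψ H : ℝ → ℝ} {c C s : ℝ} {n : ℕ}

theorem contDiff (W : StabilityWeights f f₁ φ φ₁ ψ H c C s n) : ContDiff ℝ 1 φ := by
  rw [contDiff_one_iff_deriv]
  refine ⟨fun t => (W.hasDerivAt t).differentiableAt, ?_⟩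
  rw [funext fun t => (W.hasDerivAt t).deriv]
  exact W.continuous_deriv

theorem contDiff_prim (W : StabilityWeights f f₁ φ φ₁ ψ H c C s n) : ContDiff ℝ 1 ψ := by
  rw [contDiff_one_iff_deriv]
  refine ⟨fun t => (W.hasDerivAt_prim t).differentiableAt, ?_⟩
  rw [funext fun t => (W.hasDerivAt_prim t).deriv]
  exact W.continuous_deriv.pow 2

theorem contDiff_pot (W : StabilityWeights f f₁ φ φ₁ ψ H c C s n) : ContDiff ℝ 1 H := by
  rw [contDiff_one_iff_deriv]
  refine ⟨fun t => (W.hasDerivAt_pot t).differentiableAt, ?_⟩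
  rw [funext fun t => (W.hasDerivAt_pot t).deriv]
  exact (W.contDiff.continuous.mul W.continuous_deriv).sub W.contDiff_prim.continuous

variable {N : ℕ} {u : EuclideanSpace ℝ (Fin N) → ℝ}

/-- The `i`-th component of the compactly supported vector field
`ψ(u) η² ∇u + H(u) ∇(η²)` with `η = ballCut R ^ (k + 2)`. -/
noncomputable def _root_.testField (ψ H : ℝ → ℝ) (u : EuclideanSpace ℝ (Fin N) → ℝ) (R : ℝ)
    (k : ℕ) (i : Fin N) (x : EuclideanSpace ℝ (Fin N)) : ℝ :=
  (fderiv ℝ u x (EuclideanSpace.single i 1) * ψ (u x)) * ballCut R x ^ ((2 * k + 2) + 2) +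
    (H (u x) * (-((2 * k + 4) * (2 / R ^ 2)) * x i)) * ballCut R x ^ ((2 * k + 1) + 2)

theorem contDiff_testField (W : StabilityWeights f f₁ φ φ₁ ψ H c C s n) (hu : ContDiff ℝ 2 u)
    (R : ℝ) (k : ℕ) (i : Fin N) : ContDiff ℝ 1 (testField ψ H u R k i) := by
  have hu1 : ContDiff ℝ 1 u := hu.of_le (by norm_num)
  have h1 : ContDiff ℝ 1 fun x => fderiv ℝ u x (EuclideanSpace.single i 1) :=
    (hu.fderiv_right (m := 1) (by norm_num)).clm_apply contDiff_const
  have h2 : ContDiff ℝ 1 fun x : EuclideanSpace ℝ (Fin N) => x i := by fun_prop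
  exact ((h1.mul (W.contDiff_prim.comp hu1)).mul (contDiff_ballCut_pow _)).add
    (((W.contDiff_pot.comp hu1).mul (contDiff_const.mul h2)).mul (contDiff_ballCut_pow _))

theorem hasCompactSupport_testField {R : ℝ} (hR : 0 < R) (k : ℕ) (i : Fin N) :
    HasCompactSupport (testField ψ H u R k i) :=
  (hasCompactSupport_mul_ballCut_pow hR _ (by positivity)).add
    (hasCompactSupport_mul_ballCut_pow hR _ (by positivity))

theorem fderiv_testField (W : StabilityWeights f f₁ φ φ₁ ψ H c C s n) (hu : ContDiff ℝ 2 u)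
    (R : ℝ) (k : ℕ) (i : Fin N) (x : EuclideanSpace ℝ (Fin N)) :
    fderiv ℝ (testField ψ H u R k i) x (EuclideanSpace.single i 1) =
      fderiv ℝ (fun y => fderiv ℝ u y (EuclideanSpace.single i 1)) x (EuclideanSpace.single i 1) *
        ψ (u x) * ballCut R x ^ (2 * k + 4) +
      fderiv ℝ u x (EuclideanSpace.single i 1) ^ 2 * φ₁ (u x) ^ 2 * ballCut R x ^ (2 * k + 4) +
      φ (u x) * φ₁ (u x) * fderiv ℝ u x (EuclideanSpace.single i 1) *
        (-((2 * k + 4) * (2 / R ^ 2)) * x i) * ballCut R x ^ (2 * k + 3) +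
      H (u x) * (-((2 * k + 4) * (2 / R ^ 2))) * ballCut R x ^ (2 * k + 3) +
      H (u x) * ((2 * k + 4) * (2 / R ^ 2)) * ((2 * k + 3) * (2 / R ^ 2)) * x i ^ 2 *
        ballCut R x ^ (2 * k + 2) := by
  have hu1 : HasFDerivAt u (fderiv ℝ u x) x := (hu.differentiable (by norm_num) x).hasFDerivAt
  have h1 : HasFDerivAt (fun y => fderiv ℝ u y (EuclideanSpace.single i 1))
      (fderiv ℝ (fun y => fderiv ℝ u y (EuclideanSpace.single i 1)) x) x :=
    (((hu.fderiv_right (m := 1) (by norm_num)).clm_apply contDiff_const).differentiable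
      (by norm_num) x).hasFDerivAt
  have h2 : HasFDerivAt (fun x : EuclideanSpace ℝ (Fin N) => x i)
      (EuclideanSpace.proj i : EuclideanSpace ℝ (Fin N) →L[ℝ] ℝ) x :=
    (EuclideanSpace.proj i : EuclideanSpace ℝ (Fin N) →L[ℝ] ℝ).hasFDerivAt
  have h3 := ((h1.mul ((W.hasDerivAt_prim (u x)).comp_hasFDerivAt x hu1)).mul
    (hasFDerivAt_ballCut_pow (R := R) (2 * k + 2) x)).add
    ((((W.hasDerivAt_pot (u x)).comp_hasFDerivAt x hu1).mul
      (h2.const_mul (-((2 * k + 4) * (2 / R ^ 2))))).mul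
      (hasFDerivAt_ballCut_pow (R := R) (2 * k + 1) x))
  have h4 : HasFDerivAt (testField ψ H u R k i) _ x := h3
  rw [h4.fderiv]
  simp [EuclideanSpace.inner_single_right]
  ring

theorem fderiv_comp_mul_ballCut_pow (W : StabilityWeights f f₁ φ φ₁ ψ H c C s n)
    (hu : ContDiff ℝ 2 u) (R : ℝ) (k : ℕ) (i : Fin N) (x : EuclideanSpace ℝ (Fin N)) :
    fderiv ℝ (fun x => φ (u x) * ballCut R x ^ (k + 2)) x (EuclideanSpace.single i 1) =
      φ₁ (u x) * fderiv ℝ u x (EuclideanSpace.single i 1) * ballCut R x ^ (k + 2) -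
      φ (u x) * ((k + 2) * (2 / R ^ 2)) * x i * ballCut R x ^ (k + 1) := by
  have hu1 : HasFDerivAt u (fderiv ℝ u x) x := (hu.differentiable (by norm_num) x).hasFDerivAt
  have h3 := ((W.hasDerivAt (u x)).comp_hasFDerivAt x hu1).mul
    (hasFDerivAt_ballCut_pow (R := R) k x)
  have h4 : HasFDerivAt (fun x => φ (u x) * ballCut R x ^ (k + 2)) _ x := h3
  rw [h4.fderiv]
  simp [EuclideanSpace.inner_single_right]
  ring

theorem norm_gradient_sq_le (W : StabilityWeights f f₁ φ φ₁ ψ H c C s n) (hu : ContDiff ℝ 2 u)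
    (hsol : ∀ x, -lap u x = f (u x)) {R : ℝ} (hR : 0 < R) (k : ℕ)
    (x : EuclideanSpace ℝ (Fin N)) :
    ‖gradient (fun x => φ (u x) * ballCut R x ^ (k + 2)) x‖ ^ 2 ≤
      (∑ i, fderiv ℝ (testField ψ H u R k i) x (EuclideanSpace.single i 1)) +
      f (u x) * ψ (u x) * ballCut R x ^ (2 * k + 4) +
      (4 * (k + 2) ^ 2 + 2 * (k + 2) * N) / R ^ 2 * φ (u x) ^ 2 * ballCut R x ^ (2 * k + 2) := by
  have hx : ∑ i, x i ^ 2 = ‖x‖ ^ 2 := (EuclideanSpace.real_norm_sq_eq x).symm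
  have hl := hsol x
  rw [lap_eq hu] at hl
  set w := ballCut R x with hw
  have hw0 : 0 ≤ w := ballCut_nonneg
  have hw1 : w ≤ 1 := ballCut_le_one
  have hH := W.pot_nonneg (u x)
  have hH2 := W.pot_le (u x)
  have h1 : ‖gradient (fun x => φ (u x) * ballCut R x ^ (k + 2)) x‖ ^ 2 =
      φ₁ (u x) ^ 2 * w ^ (2 * k + 4) *
        (∑ i, fderiv ℝ u x (EuclideanSpace.single i 1) ^ 2) -
      φ (u x) * φ₁ (u x) * ((2 * k + 4) * (2 / R ^ 2)) * w ^ (2 * k + 3) *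
        (∑ i, fderiv ℝ u x (EuclideanSpace.single i 1) * x i) +
      φ (u x) ^ 2 * ((k + 2) * (2 / R ^ 2)) ^ 2 * w ^ (2 * k + 2) * ‖x‖ ^ 2 := by
    rw [norm_gradient_sq, ← hx]
    simp only [W.fderiv_comp_mul_ballCut_pow hu, Finset.mul_sum]
    rw [← Finset.sum_sub_distrib, ← Finset.sum_add_distrib]
    exact Finset.sum_congr rfl fun i _ => by ring
  have h2 : ∑ i, fderiv ℝ (testField ψ H u R k i) x (EuclideanSpace.single i 1) =
      -f (u x) * (ψ (u x) * w ^ (2 * k + 4)) +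
      φ₁ (u x) ^ 2 * w ^ (2 * k + 4) *
        (∑ i, fderiv ℝ u x (EuclideanSpace.single i 1) ^ 2) -
      φ (u x) * φ₁ (u x) * ((2 * k + 4) * (2 / R ^ 2)) * w ^ (2 * k + 3) *
        (∑ i, fderiv ℝ u x (EuclideanSpace.single i 1) * x i) -
      N * (H (u x) * ((2 * k + 4) * (2 / R ^ 2)) * w ^ (2 * k + 3)) +
      H (u x) * ((2 * k + 4) * (2 / R ^ 2)) * ((2 * k + 3) * (2 / R ^ 2)) *
        w ^ (2 * k + 2) * ‖x‖ ^ 2 := by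
    rw [← hl, neg_neg, ← hx]
    have hN : ∀ a : ℝ, (N : ℝ) * a = ∑ _i : Fin N, a := fun a => by simp
    rw [hN]
    simp only [W.fderiv_testField hu, Finset.mul_sum, Finset.sum_mul]
    rw [← Finset.sum_add_distrib, ← Finset.sum_sub_distrib, ← Finset.sum_sub_distrib,
      ← Finset.sum_add_distrib]
    exact Finset.sum_congr rfl fun i _ => by ring
  rw [h1, h2]
  have h3 : w ^ (2 * k + 2) * ‖x‖ ^ 2 ≤ w ^ (2 * k + 2) * R ^ 2 := by
    by_cases h : w = 0
    · simp [h]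
    · have := (norm_lt_of_ballCut_ne_zero hR h).le
      gcongr
  have h4 : φ (u x) ^ 2 * ((k + 2) * (2 / R ^ 2)) ^ 2 * (w ^ (2 * k + 2) * ‖x‖ ^ 2) ≤
      φ (u x) ^ 2 * ((k + 2) * (2 / R ^ 2)) ^ 2 * (w ^ (2 * k + 2) * R ^ 2) := by gcongr
  have h5 : φ (u x) ^ 2 * ((k + 2) * (2 / R ^ 2)) ^ 2 * (w ^ (2 * k + 2) * R ^ 2) =
      4 * (k + 2) ^ 2 / R ^ 2 * φ (u x) ^ 2 * w ^ (2 * k + 2) := by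
    field_simp
    ring
  have h6 : N * (H (u x) * ((2 * k + 4) * (2 / R ^ 2)) * w ^ (2 * k + 3)) ≤
      N * (φ (u x) ^ 2 / 2 * ((2 * k + 4) * (2 / R ^ 2)) * w ^ (2 * k + 2)) := by
    have : w ^ (2 * k + 3) ≤ w ^ (2 * k + 2) := pow_le_pow_of_le_one hw0 hw1 (by omega)
    gcongr
  have h7 : 0 ≤ H (u x) * ((2 * k + 4) * (2 / R ^ 2)) * ((2 * k + 3) * (2 / R ^ 2)) *
        w ^ (2 * k + 2) * ‖x‖ ^ 2 := by positivity
  have h8 : (4 * (k + 2) ^ 2 + 2 * (k + 2) * N) / R ^ 2 * φ (u x) ^ 2 * w ^ (2 * k + 2) =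
      4 * (k + 2) ^ 2 / R ^ 2 * φ (u x) ^ 2 * w ^ (2 * k + 2) +
      N * (φ (u x) ^ 2 / 2 * ((2 * k + 4) * (2 / R ^ 2)) * w ^ (2 * k + 2)) := by
    ring
  rw [h8]
  linarith

theorem integral_le (W : StabilityWeights f f₁ φ φ₁ ψ H c C s n) (hu : ContDiff ℝ 2 u)
    (hf : Continuous f) (hf₁ : Continuous f₁)
    (hsol : ∀ x, -lap u x = f (u x)) (hstab : Stable f₁ u) {R : ℝ} (hR : 0 < R) (k : ℕ) :
    c * ∫ x, f₁ (u x) * φ (u x) ^ 2 * ballCut R x ^ (2 * k + 4) ≤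
      ∫ x, (4 * (k + 2) ^ 2 + 2 * (k + 2) * N) / R ^ 2 * φ (u x) ^ 2 *
        ballCut R x ^ (2 * k + 2) := by
  have hu0 := hu.continuous
  have hφ := W.contDiff.continuous
  have hψ := W.contDiff_prim.continuous
  have hw := continuous_ballCut (N := N) (R := R)
  have hint : ∀ (F : EuclideanSpace ℝ (Fin N) → ℝ) (m : ℕ), Continuous F → m ≠ 0 →
      Integrable fun x => F x * ballCut R x ^ m := fun F m hF hm =>
    (hF.mul (hw.pow m)).integrable_of_hasCompactSupport
      (hasCompactSupport_mul_ballCut_pow hR F hm)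
  have hle := W.norm_gradient_sq_le hu hsol hR k
  set η : EuclideanSpace ℝ (Fin N) → ℝ := fun x => φ (u x) * ballCut R x ^ (k + 2) with hη
  have hη1 : ContDiff ℝ 1 η :=
    (W.contDiff.comp (hu.of_le (by norm_num))).mul (contDiff_ballCut_pow k)
  have hηc : HasCompactSupport η := hasCompactSupport_mul_ballCut_pow hR _ (by positivity)
  have hst := hstab η hη1 hηc
  have e1 : ∀ x, f₁ (u x) * η x ^ 2 = f₁ (u x) * φ (u x) ^ 2 * ballCut R x ^ (2 * k + 4) :=
    fun x => by simp only [hη]; ring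
  simp only [e1] at hst
  have i1 : Integrable fun x => f₁ (u x) * φ (u x) ^ 2 * ballCut R x ^ (2 * k + 4) :=
    hint _ _ (by fun_prop) (by positivity)
  have i2 : Integrable fun x => f (u x) * ψ (u x) * ballCut R x ^ (2 * k + 4) :=
    hint _ _ (by fun_prop) (by positivity)
  have i3 : Integrable fun x => (4 * (k + 2) ^ 2 + 2 * (k + 2) * N) / R ^ 2 * φ (u x) ^ 2 *
        ballCut R x ^ (2 * k + 2) := hint _ _ (by fun_prop) (by positivity)
  have i4 : ∀ i : Fin N, Integrable fun x =>
      fderiv ℝ (testField ψ H u R k i) x (EuclideanSpace.single i 1) := fun i =>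
    (((W.contDiff_testField hu R k i).continuous_fderiv (by norm_num)).clm_apply
      continuous_const).integrable_of_hasCompactSupport
      ((hasCompactSupport_testField hR k i).fderiv_apply (𝕜 := ℝ) _)
  have i5 : Integrable fun x => ∑ i : Fin N,
      fderiv ℝ (testField ψ H u R k i) x (EuclideanSpace.single i 1) :=
    integrable_finsetSum _ fun i _ => i4 i
  have i6 : Integrable fun x => ‖gradient η x‖ ^ 2 := integrable_norm_gradient_sq hη1 hηc
  have h0 : ∫ x, ∑ i : Fin N,
      fderiv ℝ (testField ψ H u R k i) x (EuclideanSpace.single i 1) = 0 := by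
    rw [integral_finsetSum _ fun i _ => i4 i]
    exact Finset.sum_eq_zero fun i _ => integral_fderiv_apply_eq_zero
      (W.contDiff_testField hu R k i) (hasCompactSupport_testField hR k i) _
  have h1 := integral_le_add_of_le i6 i5 i2 i3 hle
  rw [h0, zero_add] at h1
  have h2 : c * ∫ x, f₁ (u x) * φ (u x) ^ 2 * ballCut R x ^ (2 * k + 4) ≤
      ∫ x, (f₁ (u x) * φ (u x) ^ 2 * ballCut R x ^ (2 * k + 4) -
        f (u x) * ψ (u x) * ballCut R x ^ (2 * k + 4)) := by
    rw [← integral_const_mul]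
    refine integral_mono (i1.const_mul c) (i1.sub i2) fun x => ?_
    have := mul_le_mul_of_nonneg_right (W.coercive (u x))
      (pow_nonneg (ballCut_nonneg (R := R) (x := x)) (2 * k + 4))
    linarith
  rw [integral_sub i1 i2] at h2
  linarith

end StabilityWeights

theorem mul_pow_le_of_growth {c C M P y s r v : ℝ} {k : ℕ} (hc : 0 < c) (hC : 0 < C) (hM : 0 < M)
    (hP : 0 ≤ P) (hy : 0 ≤ y) (hs : 0 < s) (hsk : s ≤ k + 1) (hPy : P ≤ C * (y ^ s + y ^ (k + 1)))
    (hr : 1 ≤ r) (hv : 0 ≤ v) (hv1 : v ≤ 1) :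
    M / r * P * v ^ (k + 1) ≤ c / 2 * (y * P * v ^ (k + 2)) +
      M * C * ((2 * M / c) ^ s + (2 * M / c) ^ (k + 1)) / r * r ^ (-s) := by
  have hr0 : 0 < r := by linarith
  have hK : 0 ≤ M * C * ((2 * M / c) ^ s + (2 * M / c) ^ (k + 1)) / r * r ^ (-s) := by positivity
  rcases hv.eq_or_lt with rfl | hv0
  · simpa using hK
  rcases le_or_gt (M / r) (c / 2 * (y * v)) with h | h
  · have : M / r * (P * v ^ (k + 1)) ≤ c / 2 * (y * v) * (P * v ^ (k + 1)) := by gcongr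
    linarith [show c / 2 * (y * v) * (P * v ^ (k + 1)) = c / 2 * (y * P * v ^ (k + 2)) by ring]
  · set B := 2 * M / c with hB
    have hB0 : 0 < B := by positivity
    have hyz : y ≤ B * r⁻¹ * v⁻¹ := by
      have h1 : M / r = c / 2 * (B * r⁻¹ * v⁻¹ * v) := by rw [hB]; field_simp
      rw [h1] at h
      exact (lt_of_mul_lt_mul_right (lt_of_mul_lt_mul_left h (by positivity)) hv).le
    have h1 : y ^ s * v ^ (k + 1) ≤ B ^ s * r ^ (-s) := by
      calc y ^ s * v ^ (k + 1) ≤ (B * r⁻¹ * v⁻¹) ^ s * v ^ (k + 1) := by gcongr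
        _ = B ^ s * r ^ (-s) * v ^ ((k + 1 : ℕ) - s) := by
          rw [Real.mul_rpow (by positivity) (by positivity),
            Real.mul_rpow (by positivity) (by positivity), Real.rpow_sub hv0, Real.rpow_natCast,
            Real.inv_rpow hr0.le, Real.inv_rpow hv, Real.rpow_neg hr0.le]
          ring
        _ ≤ B ^ s * r ^ (-s) * 1 := by
          gcongr
          exact Real.rpow_le_one hv hv1 (by push_cast; linarith)
        _ = _ := mul_one _
    have h2 : y ^ (k + 1) * v ^ (k + 1) ≤ B ^ (k + 1) * r ^ (-s) := by
      calc y ^ (k + 1) * v ^ (k + 1) ≤ (B * r⁻¹ * v⁻¹) ^ (k + 1) * v ^ (k + 1) := by gcongr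
        _ = B ^ (k + 1) * r ^ (-((k + 1 : ℕ) : ℝ)) := by
          rw [Real.rpow_neg hr0.le, Real.rpow_natCast, ← mul_pow, ← inv_pow, ← mul_pow,
            inv_mul_cancel_right₀ hv0.ne']
        _ ≤ B ^ (k + 1) * r ^ (-s) := by
          gcongr
          push_cast
          exact hsk
    calc M / r * P * v ^ (k + 1) ≤ M / r * (C * (y ^ s + y ^ (k + 1))) * v ^ (k + 1) := by gcongr
      _ = M / r * C * (y ^ s * v ^ (k + 1) + y ^ (k + 1) * v ^ (k + 1)) := by ring
      _ ≤ M / r * C * (B ^ s * r ^ (-s) + B ^ (k + 1) * r ^ (-s)) := by gcongr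
      _ = M * C * (B ^ s + B ^ (k + 1)) / r * r ^ (-s) := by ring
      _ ≤ _ := le_add_of_nonneg_left (by positivity)

namespace StabilityWeights

variable {f f₁ φ φ₁ ψ H : ℝ → ℝ} {c C s : ℝ} {k N : ℕ} {u : EuclideanSpace ℝ (Fin N) → ℝ}

theorem exists_integral_le_rpow (W : StabilityWeights f f₁ φ φ₁ ψ H c C s (k + 1))
    (hu : ContDiff ℝ 2 u) (hf : Continuous f) (hf₁ : Continuous f₁) (hf₁' : ∀ t, 0 ≤ f₁ t)
    (hsol : ∀ x, -lap u x = f (u x)) (hstab : Stable f₁ u) (hs : 0 < s) (hsk : s ≤ k + 1) :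
    ∃ K : ℝ, ∀ R : ℝ, 1 ≤ R →
      ∫ x, f₁ (u x) * φ (u x) ^ 2 * ballCut R x ^ (2 * k + 4) ≤ K * R ^ (N - 2 - 2 * s : ℝ) := by
  have hc := W.c_pos
  set M : ℝ := 4 * (k + 2) ^ 2 + 2 * (k + 2) * N with hM
  have hM0 : 0 < M := by positivity
  set A : ℝ := M * C * ((2 * M / c) ^ s + (2 * M / c) ^ (k + 1)) with hA
  set V : ℝ := volume.real (Metric.closedBall (0 : EuclideanSpace ℝ (Fin N)) 1) with hV
  refine ⟨2 / c * A * V, fun R hR => ?_⟩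
  have hR0 : 0 < R := by linarith
  have hu0 := hu.continuous
  have hφ := W.contDiff.continuous
  have hw := continuous_ballCut (N := N) (R := R)
  have h1 := W.integral_le hu hf hf₁ hsol hstab hR0 k
  have i1 : Integrable fun x => f₁ (u x) * φ (u x) ^ 2 * ballCut R x ^ (2 * k + 4) :=
    Continuous.integrable_of_hasCompactSupport (by fun_prop)
      (hasCompactSupport_mul_ballCut_pow hR0 _ (by positivity))
  have i2 : Integrable fun x => M / R ^ 2 * φ (u x) ^ 2 * ballCut R x ^ (2 * k + 2) :=
    Continuous.integrable_of_hasCompactSupport (by fun_prop)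
      (hasCompactSupport_mul_ballCut_pow hR0 _ (by positivity))
  have i3 : Integrable ((Metric.closedBall (0 : EuclideanSpace ℝ (Fin N)) R).indicator
      fun _ => A / R ^ 2 * (R ^ 2) ^ (-s)) :=
    (integrable_indicator_iff Metric.isClosed_closedBall.measurableSet).2
      (integrableOn_const (isCompact_closedBall _ _).measure_lt_top.ne)
  have h2 : ∀ x, M / R ^ 2 * φ (u x) ^ 2 * ballCut R x ^ (2 * k + 2) ≤
      c / 2 * (f₁ (u x) * φ (u x) ^ 2 * ballCut R x ^ (2 * k + 4)) +
      (Metric.closedBall (0 : EuclideanSpace ℝ (Fin N)) R).indicator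
        (fun _ => A / R ^ 2 * (R ^ 2) ^ (-s)) x := by
    intro x
    by_cases hx : ballCut R x = 0
    · have : 0 ≤ A := by have := W.C_pos; positivity
      rw [hx, zero_pow (by positivity), zero_pow (by positivity)]
      simp only [mul_zero, zero_add]
      exact Set.indicator_nonneg (fun _ _ => by positivity) _
    · have hx' : x ∈ Metric.closedBall (0 : EuclideanSpace ℝ (Fin N)) R := by
        simpa using (norm_lt_of_ballCut_ne_zero hR0 hx).le
      rw [Set.indicator_of_mem hx']
      have h3 := mul_pow_le_of_growth (k := k) hc W.C_pos hM0 (sq_nonneg (φ (u x))) (hf₁' (u x))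
        hs hsk (W.growth (u x)) (one_le_pow₀ hR (n := 2)) (sq_nonneg (ballCut R x))
        (pow_le_one₀ ballCut_nonneg ballCut_le_one)
      rwa [← pow_mul, ← pow_mul, mul_add 2 k 1, mul_add 2 k 2] at h3
  have h3 := integral_mono i2 ((i1.const_mul (c / 2)).add i3) h2
  have h4 : ∫ x, (c / 2 * (f₁ (u x) * φ (u x) ^ 2 * ballCut R x ^ (2 * k + 4)) +
      (Metric.closedBall (0 : EuclideanSpace ℝ (Fin N)) R).indicator
        (fun _ => A / R ^ 2 * (R ^ 2) ^ (-s)) x) =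
      c / 2 * (∫ x, f₁ (u x) * φ (u x) ^ 2 * ballCut R x ^ (2 * k + 4)) +
        R ^ N * V * (A / R ^ 2 * (R ^ 2) ^ (-s)) := by
    rw [integral_add (i1.const_mul _) i3, integral_const_mul,
      integral_indicator Metric.isClosed_closedBall.measurableSet, setIntegral_const, smul_eq_mul,
      Measure.addHaar_real_closedBall' _ _ hR0.le]
    simp [hV]
  have h5 : R ^ (N - 2 - 2 * s : ℝ) = R ^ N / R ^ 2 * (R ^ 2) ^ (-s) := by
    rw [sub_eq_add_neg, Real.rpow_add hR0, Real.rpow_sub hR0, Real.rpow_natCast,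
      ← Real.rpow_natCast R 2, ← Real.rpow_mul hR0.le]
    norm_num
  have h6 := h1.trans (h3.trans h4.le)
  rw [h5]
  calc ∫ x, f₁ (u x) * φ (u x) ^ 2 * ballCut R x ^ (2 * k + 4)
      = 2 / c * (c / 2 * ∫ x, f₁ (u x) * φ (u x) ^ 2 * ballCut R x ^ (2 * k + 4)) := by
        field_simp
    _ ≤ 2 / c * (R ^ N * V * (A / R ^ 2 * (R ^ 2) ^ (-s))) := by
        exact mul_le_mul_of_nonneg_left (by linarith) (by positivity)
    _ = _ := by ring

theorem eq_zero (W : StabilityWeights f f₁ φ φ₁ ψ H c C s (k + 1))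
    (hu : ContDiff ℝ 2 u) (hf : Continuous f) (hf₁ : Continuous f₁) (hf₁' : ∀ t, 0 ≤ f₁ t)
    (hf₁0 : ∀ t, t ≠ 0 → 0 < f₁ t) (hsol : ∀ x, -lap u x = f (u x)) (hstab : Stable f₁ u)
    (hs : 0 < s) (hsk : s ≤ k + 1) (hsN : N - 2 < 2 * s) (x : EuclideanSpace ℝ (Fin N)) :
    u x = 0 := by
  by_contra hx
  obtain ⟨K, hK⟩ := W.exists_integral_le_rpow hu hf hf₁ hf₁' hsol hstab hs hsk
  have hu0 := hu.continuous
  have hφ := W.contDiff.continuous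
  have hc : ∀ R : ℝ, Continuous fun x =>
      f₁ (u x) * φ (u x) ^ 2 * ballCut R x ^ (2 * k + 4) := fun R => by
    have hw := continuous_ballCut (N := N) (R := R)
    fun_prop
  have hcs : ∀ R : ℝ, 0 < R → HasCompactSupport fun x =>
      f₁ (u x) * φ (u x) ^ 2 * ballCut R x ^ (2 * k + 4) := fun R hR =>
    hasCompactSupport_mul_ballCut_pow hR _ (by positivity)
  have hr : 0 < ‖x‖ + 1 := by positivity
  have hpos : 0 < ∫ y, f₁ (u y) * φ (u y) ^ 2 * ballCut (‖x‖ + 1) y ^ (2 * k + 4) := by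
    refine (hc _).integral_pos_of_hasCompactSupport_nonneg_nonzero (hcs _ hr)
      (fun y => mul_nonneg (mul_nonneg (hf₁' _) (sq_nonneg _)) (pow_nonneg ballCut_nonneg _))
      (x := x) ?_
    have h1 := hf₁0 _ hx
    have h2 := W.ne_zero _ hx
    have h3 : 0 < ballCut (‖x‖ + 1) x := ballCut_pos (by linarith)
    positivity
  have hlim : Tendsto (fun R : ℝ => K * R ^ (N - 2 - 2 * s : ℝ)) atTop (𝓝 0) := by
    have := (tendsto_rpow_neg_atTop (y := 2 * s - (N - 2)) (by linarith)).const_mul K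
    rw [mul_zero] at this
    refine this.congr fun R => ?_
    rw [neg_sub]
  refine hpos.not_ge (ge_of_tendsto hlim ?_)
  filter_upwards [eventually_ge_atTop (‖x‖ + 1)] with R hR
  have hR1 : 1 ≤ R := by linarith [norm_nonneg x]
  refine le_trans ?_ (hK R hR1)
  refine integral_mono ((hc _).integrable_of_hasCompactSupport (hcs _ hr))
    ((hc _).integrable_of_hasCompactSupport (hcs _ (by linarith))) fun y => ?_
  have h1 := ballCut_mono (x := y) hr hR
  have h2 := ballCut_nonneg (R := ‖x‖ + 1) (x := y)
  have h3 := hf₁' (u y)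
  dsimp only
  gcongr

end StabilityWeights

theorem exists_eq_ofReal_of_conjugate {p q : ℝ≥0∞} (hpq : 1 / p + 1 / q = 1) (hp : 1 < p) :
    ∃ Q : ℝ, 1 ≤ Q ∧ q = ENNReal.ofReal Q ∧ (p < ⊤ → Q⁻¹ = 1 - p.toReal⁻¹) := by
  rw [one_div, one_div] at hpq
  have hq : q ≠ ⊤ := by
    rintro rfl
    rw [ENNReal.inv_top, add_zero, ENNReal.inv_eq_one] at hpq
    exact hp.ne' hpq
  have hq1 : 1 ≤ q := by
    rw [← ENNReal.inv_le_one, ← hpq]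
    exact le_add_self
  refine ⟨q.toReal, by simpa using ENNReal.toReal_mono hq hq1, (ENNReal.ofReal_toReal hq).symm,
    fun _ => ?_⟩
  have h := congrArg ENNReal.toReal hpq
  rw [ENNReal.toReal_add (ENNReal.inv_ne_top.2 (by positivity))
    (ENNReal.inv_ne_top.2 (zero_lt_one.trans_le hq1).ne'), ENNReal.toReal_inv,
    ENNReal.toReal_inv, ENNReal.toReal_one] at h
  linarith

theorem pc_eq {N : ℕ} (hN : 11 ≤ N) :
    pc N = (√((N : ℝ) - 1) - 1) ^ 2 / ((√((N : ℝ) - 1) - 1) ^ 2 - 4) := by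
  have hN' : (11 : ℝ) ≤ N := by exact_mod_cast hN
  have hm := Real.sq_sqrt (show (0 : ℝ) ≤ (N : ℝ) - 1 by linarith)
  have hm3 : 3 < √((N : ℝ) - 1) := Real.lt_sqrt_of_sq_lt (by linarith)
  unfold pc
  generalize √((N : ℝ) - 1) = m at hm hm3 ⊢
  rw [show (N : ℝ) = m ^ 2 + 1 by linarith]
  have h1 : m ^ 2 + 1 - 2 ≠ 0 := by nlinarith
  have h2 : m ^ 2 + 1 - 10 ≠ 0 := by nlinarith
  have h3 : (m - 1) ^ 2 - 4 ≠ 0 := by nlinarith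
  rw [div_eq_div_iff (mul_ne_zero h1 h2) h3]
  ring

theorem sub_two_mul_lt_of_lt_pc {N : ℕ} (hN : 11 ≤ N) {P x : ℝ} (hP : 0 < P) (hPN : P < pc N)
    (hx : x = 1 - P⁻¹) : (N - 2) * x < 4 * (1 + √x) := by
  have hN' : (11 : ℝ) ≤ N := by exact_mod_cast hN
  rcases le_or_gt x 0 with hx0 | hx0
  · nlinarith [Real.sqrt_nonneg x]
  have hm := Real.sq_sqrt (show (0 : ℝ) ≤ (N : ℝ) - 1 by linarith)
  have hm3 : 3 < √((N : ℝ) - 1) := Real.lt_sqrt_of_sq_lt (by linarith)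
  rw [pc_eq hN] at hPN
  have hr := Real.sq_sqrt hx0.le
  have hr0 := Real.sqrt_pos.2 hx0
  generalize √((N : ℝ) - 1) = m at hm hm3 hPN
  generalize √x = r at hr hr0 ⊢
  have h1 : 0 < (m - 1) ^ 2 - 4 := by nlinarith
  have h2 : 1 - 4 / (m - 1) ^ 2 < P⁻¹ := by
    have h3 := inv_strictAnti₀ hP hPN
    rw [inv_div, sub_div, div_self (by nlinarith)] at h3
    exact h3
  have h3 : r ^ 2 < 4 / (m - 1) ^ 2 := by linarith
  rw [lt_div_iff₀ (by nlinarith)] at h3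
  have h4 : r * (m - 1) < 2 := by nlinarith [mul_pos hr0 (show 0 < m - 1 by linarith)]
  obtain rfl : x = r ^ 2 := hr.symm
  have h5 : (N : ℝ) - 2 = (m + 1) * (m - 1) := by linarith
  rw [h5]
  nlinarith [mul_pos hr0 (show 0 < m + 1 by linarith)]

theorem exists_parameters {N : ℕ} {x : ℝ} (hx : 0 < x) (hx1 : x ≤ 1)
    (h : (N - 2) * x < 4 * (1 + √x)) :
    ∃ ρ κ a : ℝ, 0 < ρ ∧ ρ ≤ 1 ∧ ρ ^ 2 < κ ∧ 0 < κ ∧ κ < x ∧ x < a ∧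
      N - 2 < 2 * (2 * (1 + ρ) / a) := by
  have hr := Real.sq_sqrt hx.le
  have hr0 := Real.sqrt_pos.2 hx
  generalize √x = r at hr hr0 h
  have hN : (0 : ℝ) ≤ N := N.cast_nonneg
  obtain ⟨ε, hε, hεr, hεN⟩ : ∃ ε : ℝ, 0 < ε ∧ ε < r ∧
      ε * (N + 4) < 4 * (1 + r) - (N - 2) * x := by
    refine ⟨min (r / 2) ((4 * (1 + r) - (N - 2) * x) / (2 * (N + 4))),
      lt_min (by positivity) (div_pos (by linarith) (by positivity)),
      (min_le_left _ _).trans_lt (by linarith), ?_⟩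
    calc _ ≤ (4 * (1 + r) - (N - 2) * x) / (2 * (N + 4)) * (N + 4) := by
          gcongr; exact min_le_right _ _
      _ = (4 * (1 + r) - (N - 2) * x) / 2 := by field_simp
      _ < _ := by linarith
  have h1 : (r - ε) ^ 2 < x := by nlinarith
  have hr1 : r ≤ 1 := by nlinarith
  refine ⟨r - ε, ((r - ε) ^ 2 + x) / 2, x + ε, by linarith, by linarith, by linarith,
    by positivity, by linarith, by linarith, ?_⟩
  rw [← mul_div_assoc, lt_div_iff₀ (by positivity)]
  nlinarith

theorem sq_le_of_qfun_le {f : ℝ → ℝ} {t b : ℝ} (h : 0 ≤ f t * deriv (deriv f) t) (hb : 0 ≤ b)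
    (hq : qfun f t ≤ ENNReal.ofReal b) :
    deriv f t ^ 2 ≤ b * (f t * deriv (deriv f) t) := by
  unfold qfun at hq
  split_ifs at hq with h0
  · simp at hq
  · have h1 : 0 < f t * deriv (deriv f) t := lt_of_le_of_ne h (Ne.symm h0)
    rwa [ENNReal.ofReal_le_ofReal_iff hb, div_le_iff₀ h1] at hq

theorem le_sq_of_le_qfun {f : ℝ → ℝ} {t b : ℝ} (h : 0 ≤ f t * deriv (deriv f) t)
    (hq : ENNReal.ofReal b ≤ qfun f t) :
    b * (f t * deriv (deriv f) t) ≤ deriv f t ^ 2 := by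
  unfold qfun at hq
  split_ifs at hq with h0
  · rw [h0, mul_zero]; positivity
  · have h1 : 0 < f t * deriv (deriv f) t := lt_of_le_of_ne h (Ne.symm h0)
    rwa [ENNReal.ofReal_le_ofReal_iff (by positivity), le_div_iff₀ h1] at hq

theorem sub_two_mul_lt_of_conjugate {N : ℕ} {p₀ pinf : ℝ≥0∞} {Q : ℝ}
    (hdim : (N ≤ 9 ∧ 1 < p₀ ∧ 1 < pinf) ∨
      (N = 10 ∧ 1 < p₀ ∧ p₀ < ⊤ ∧ 1 < pinf ∧ pinf < ⊤) ∨
      (11 ≤ N ∧ 1 < p₀ ∧ p₀ < ENNReal.ofReal (pc N) ∧ 1 < pinf ∧ pinf < ENNReal.ofReal (pc N)))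
    (hQ : 1 ≤ Q) (hp : p₀ < ⊤ → Q⁻¹ = 1 - p₀.toReal⁻¹) :
    (N - 2) * Q⁻¹ < 4 * (1 + √Q⁻¹) := by
  have hx : 0 < Q⁻¹ := by positivity
  have hx1 : Q⁻¹ ≤ 1 := inv_le_one_of_one_le₀ hQ
  have hr := Real.sq_sqrt hx.le
  have hr0 := Real.sqrt_pos.2 hx
  have hr1 : √Q⁻¹ ≤ 1 := Real.sqrt_le_one.2 hx1
  rcases hdim with ⟨hN, -, -⟩ | ⟨rfl, h1, h2, -, -⟩ | ⟨hN, h1, h2, -, -⟩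
  · have hN' : (N : ℝ) ≤ 9 := by exact_mod_cast hN
    have h1 : (N - 2) * Q⁻¹ ≤ 7 * Q⁻¹ := by gcongr; linarith
    nlinarith
  · have h3 : 0 < p₀.toReal := ENNReal.toReal_pos (zero_lt_one.trans h1).ne' h2.ne
    have h4 : Q⁻¹ < 1 := by rw [hp h2]; linarith [inv_pos.2 h3]
    push_cast
    nlinarith
  · have h3 := h2.trans ENNReal.ofReal_lt_top
    have h4 : 0 < p₀.toReal := ENNReal.toReal_pos (zero_lt_one.trans h1).ne' h3.ne
    have h5 : p₀.toReal < pc N := (ENNReal.lt_ofReal_iff_toReal_lt h3.ne).1 h2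
    exact sub_two_mul_lt_of_lt_pc hN h4 h5 (hp h3)

theorem OddConvex.exists_qfun_bounds {f : ℝ → ℝ} (h : OddConvex f (deriv f) (deriv (deriv f)))
    {q₀ : ℝ≥0∞} (hq : Tendsto (qfun f) (𝓝[>] (0 : ℝ)) (𝓝 q₀)) {Q κ a : ℝ} (hQ : 0 < Q)
    (hqQ : q₀ = ENNReal.ofReal Q) (hκ : 0 < κ) (hκQ : κ < Q⁻¹) (ha : Q⁻¹ < a) :
    ∃ t₀ : ℝ, 0 < t₀ ∧
      (∀ t, 0 < t → t < t₀ → κ * deriv f t ^ 2 ≤ f t * deriv (deriv f) t) ∧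
      ∀ t, 0 < t → t < t₀ → f t * deriv (deriv f) t ≤ a * deriv f t ^ 2 := by
  have ha0 : 0 < a := (inv_pos.2 hQ).trans ha
  have h1 : q₀ < ENNReal.ofReal κ⁻¹ := by
    rw [hqQ, ENNReal.ofReal_lt_ofReal_iff (by positivity)]
    exact (lt_inv_comm₀ hκ hQ).1 hκQ
  have h2 : ENNReal.ofReal a⁻¹ < q₀ := by
    rw [hqQ, ENNReal.ofReal_lt_ofReal_iff hQ]
    exact (inv_lt_comm₀ hQ ha0).1 ha
  have h3 := (hq.eventually_lt_const h1).and (hq.eventually_const_lt h2)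
  obtain ⟨t₀, ht₀, ht⟩ := mem_nhdsGT_iff_exists_Ioo_subset.1 h3
  have hff : ∀ t, 0 < t → 0 ≤ f t * deriv (deriv f) t := fun t ht =>
    mul_nonneg (h.pos t ht).le (h.deriv2_nonneg t ht)
  refine ⟨t₀, ht₀, fun t h4 h5 => ?_, fun t h4 h5 => ?_⟩
  · have := sq_le_of_qfun_le (hff t h4) (by positivity) (ht ⟨h4, h5⟩).1.le
    rwa [← div_eq_inv_mul, le_div_iff₀' hκ] at this
  · have := le_sq_of_le_qfun (hff t h4) (ht ⟨h4, h5⟩).2.le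
    rwa [← div_eq_inv_mul, div_le_iff₀' ha0] at this

theorem OddConvex.exists_sq_le_mul_of_limsup {f : ℝ → ℝ}
    (h : OddConvex f (deriv f) (deriv (deriv f))) (hq : limsup (qfun f) atTop ≠ ⊤) (t₀ s : ℝ) :
    ∃ (n : ℕ) (t₁ : ℝ), s ≤ n ∧ 0 < n ∧ 0 < t₁ ∧ t₀ ≤ t₁ ∧
      ∀ t, t₁ < t → deriv f t ^ 2 ≤ n * (f t * deriv (deriv f) t) := by
  obtain ⟨m, hm⟩ := ENNReal.exists_nat_gt hq
  obtain ⟨t₁, ht₁⟩ := eventually_atTop.1 (eventually_lt_of_limsup_lt hm)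
  refine ⟨max m (⌈s⌉₊ + 1), max (max t₁ t₀) 1, ?_, by positivity, by positivity,
    (le_max_right _ _).trans (le_max_left _ _), fun t ht => ?_⟩
  · refine (Nat.le_ceil s).trans ?_
    exact_mod_cast (Nat.le_succ _).trans (le_max_right _ _)
  · have ht0 : 0 < t := lt_trans (by positivity) ht
    have htt : t₁ ≤ t := ((le_max_left _ _).trans (le_max_left _ _)).trans ht.le
    refine sq_le_of_qfun_le (mul_nonneg (h.pos t ht0).le (h.deriv2_nonneg t ht0))
      (Nat.cast_nonneg _) ((ht₁ t htt).le.trans ?_)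
    rw [ENNReal.ofReal_natCast]
    exact_mod_cast le_max_left _ _

/-- Corollary 1.10: Liouville theorem for arbitrary (possibly unbounded, sign-changing)
stable solutions when `f` is odd, under conditions on both `p₀` and `p̲_∞`. -/
theorem stmt5 {N : ℕ} (hN : 1 ≤ N) (f : ℝ → ℝ)
    (hcont : Continuous f) (hC2 : ContDiffOn ℝ 2 f (Set.Ioi 0))
    (hmono : Monotone f) (hodd : ∀ t : ℝ, f (-t) = -f t)
    (hconv : ConvexOn ℝ (Set.Ioi 0) f)
    (hpos : ∀ t : ℝ, 0 < t → 0 < f t)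
    (q₀ p₀ : ℝ≥0∞) (hq : Tendsto (qfun f) (𝓝[>] (0:ℝ)) (𝓝 q₀))
    (hpq : 1 / p₀ + 1 / q₀ = 1)
    (qinf pinf : ℝ≥0∞) (hqinf : qinf = Filter.limsup (qfun f) Filter.atTop)
    (hpinf : 1 / pinf + 1 / qinf = 1)
    (u : EuclideanSpace ℝ (Fin N) → ℝ) (hu : ContDiff ℝ 2 u)
    (hsol : ∀ x, -lap u x = f (u x)) (hstab : Stable (deriv f) u)
    (hdim : (N ≤ 9 ∧ 1 < p₀ ∧ 1 < pinf) ∨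
      (N = 10 ∧ 1 < p₀ ∧ p₀ < ⊤ ∧ 1 < pinf ∧ pinf < ⊤) ∨
      (11 ≤ N ∧ 1 < p₀ ∧ p₀ < ENNReal.ofReal (pc N) ∧ 1 < pinf ∧ pinf < ENNReal.ofReal (pc N))) :
    ∀ x, u x = 0 := by
  have h := oddConvex_of_convexOn hcont hC2 hmono hodd hconv hpos
  have hp₀ : 1 < p₀ := by tauto
  have hp : 1 < pinf := by tauto
  obtain ⟨Q, hQ, hqQ, hQp⟩ := exists_eq_ofReal_of_conjugate hpq hp₀
  obtain ⟨Q', -, hqQ', -⟩ := exists_eq_ofReal_of_conjugate hpinf hp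
  have hQ0 : 0 < Q := by linarith
  have hQ1 : Q⁻¹ ≤ 1 := inv_le_one_of_one_le₀ hQ
  obtain ⟨ρ, κ, a, hρ, hρ1, hκ, hκ0, hκQ, ha, hNa⟩ := exists_parameters (inv_pos.2 hQ0) hQ1
    (sub_two_mul_lt_of_conjugate hdim hQ hQp)
  have ha0 : 0 < a := (inv_pos.2 hQ0).trans ha
  obtain ⟨t₀, ht₀, hlow, hup⟩ := h.exists_qfun_bounds hq hQ0 hqQ hκ0 hκQ ha
  have hlim : limsup (qfun f) atTop ≠ ⊤ := by
    rw [← hqinf, hqQ']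
    exact ENNReal.ofReal_ne_top
  obtain ⟨n, t₁, hsn, hn, -, ht₁, hinf⟩ :=
    h.exists_sq_le_mul_of_limsup hlim t₀ (2 * (1 + ρ) / a)
  obtain ⟨φ, φ₁, ψ, H, c, C, W⟩ := h.exists_stabilityWeights hρ hρ1 hκ (hκQ.le.trans hQ1) ha0 ht₀
    ht₁ hlow hup hinf
  obtain ⟨k, hk⟩ : ∃ k, 2 * n = k + 1 := ⟨2 * n - 1, by omega⟩
  rw [hk] at W
  have hnk : (n : ℝ) ≤ k + 1 := by exact_mod_cast (by omega : n ≤ k + 1)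
  refine W.eq_zero hu hcont h.continuous_deriv h.deriv_nonneg (fun t ht => ?_) hsol hstab
    (by positivity) (hsn.trans hnk) hNa
  rcases ht.lt_or_gt with ht | ht
  · rw [← h.deriv_even]
    exact h.deriv_pos _ (by linarith)
  · exact h.deriv_pos t ht
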